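/- Refined fourth-order expansion for Cover–Thomas symmetric channels: Let P_{Y|X} be a Cover–Thomas symmetric channel with dispersion V > 0 under the uniform input distribution P*, and let ε_n be an SMD sequence. Then ζ(n,ε_n) = (1/2)·log n + S·Q^{-1}(ε_n)² − [(3(μ₄ − 3V²)V − 4μ₃²)/(72 V^{5/2})]·Q^{-1}(ε_n)³/√n + O(Q^{-1}(ε_n)⁴/n) + O(1), where S = Sk_u(P*)·√V/6 + 1/2 and μ_k = E[(ı(X;Y) − C)^k] is the k-th central moment of the information density under X ~ P*. -/

import Mathlib

open Filter MeasureTheory Finset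
open scoped Classical

noncomputable section

def gaussQ (x : ℝ) : ℝ := ∫ t in Set.Ioi x, (Real.sqrt (2 * Real.pi))⁻¹ * Real.exp (-t ^ 2 / 2)

def gaussQinv : ℝ → ℝ := Function.invFun gaussQ

def IsSMD (ε : ℕ → ℝ) : Prop :=
  (∀ n, ε n ∈ Set.Ioo (0 : ℝ) 1) ∧
  Tendsto (fun n : ℕ => Real.log (1 / ε n) / (n : ℝ)) atTop (nhds 0) ∧
  Tendsto (fun n : ℕ => Real.log (1 / (1 - ε n)) / (n : ℝ)) atTop (nhds 0)

variable {𝓧 𝓨 : Type*} [Fintype 𝓧] [Fintype 𝓨]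

def IsKernel (W : 𝓧 → 𝓨 → ℝ) : Prop :=
  (∀ x y, 0 ≤ W x y) ∧ ∀ x, ∑ y, W x y = 1

def IsDist (p : 𝓧 → ℝ) : Prop := (∀ x, 0 ≤ p x) ∧ ∑ x, p x = 1

/-- Cover–Thomas symmetric channel: every row of the transition matrix is a permutation of
every other row, and every column is a permutation of every other column. -/
def CoverThomasSymmetric (W : 𝓧 → 𝓨 → ℝ) : Prop :=
  (∀ x x' : 𝓧, ∃ σ : 𝓨 ≃ 𝓨, ∀ y, W x' y = W x (σ y)) ∧
  (∀ y y' : 𝓨, ∃ σ : 𝓧 ≃ 𝓧, ∀ x, W x y' = W (σ x) y)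

def avgErr (W : 𝓧 → 𝓨 → ℝ) (n M : ℕ) (f : Fin M → Fin n → 𝓧)
    (g : (Fin n → 𝓨) → Fin M) : ℝ :=
  1 - (M : ℝ)⁻¹ * ∑ m : Fin M, ∑ y : Fin n → 𝓨,
    (if g y = m then ∏ i, W (f m i) (y i) else 0)

def ExistsCode (W : 𝓧 → 𝓨 → ℝ) (n M : ℕ) (e : ℝ) : Prop :=
  ∃ f : Fin M → Fin n → 𝓧, ∃ g : (Fin n → 𝓨) → Fin M, avgErr W n M f g ≤ e

def Mstar (W : 𝓧 → 𝓨 → ℝ) (n : ℕ) (e : ℝ) : ℕ := sSup {M | ExistsCode W n M e}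

def outDist (W : 𝓧 → 𝓨 → ℝ) (p : 𝓧 → ℝ) (y : 𝓨) : ℝ := ∑ x, p x * W x y

def iDen (W : 𝓧 → 𝓨 → ℝ) (p : 𝓧 → ℝ) (x : 𝓧) (y : 𝓨) : ℝ :=
  Real.log (W x y / outDist W p y)

def mutInfo (W : 𝓧 → 𝓨 → ℝ) (p : 𝓧 → ℝ) : ℝ :=
  ∑ x, ∑ y, p x * W x y * iDen W p x y

def capacity (W : 𝓧 → 𝓨 → ℝ) : ℝ := sSup (mutInfo W '' {p | IsDist p})

/-- The uniform input distribution. -/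
def unifDist (𝓧 : Type*) [Fintype 𝓧] : 𝓧 → ℝ := fun _ => (Fintype.card 𝓧 : ℝ)⁻¹

/-- `μ_k = E[(ı(X;Y) − C)^k]`, the k-th central moment of the information density under the
uniform input distribution. -/
def ctMoment (W : 𝓧 → 𝓨 → ℝ) (k : ℕ) : ℝ :=
  ∑ x, ∑ y, unifDist 𝓧 x * W x y * (iDen W (unifDist 𝓧) x y - capacity W) ^ k

/-- The dispersion `V` of a Cover–Thomas symmetric channel (under the uniform input). -/
def ctV (W : 𝓧 → 𝓨 → ℝ) : ℝ := ctMoment W 2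

/-- The channel skewness `S = Sk_u(P*)·√V/6 + 1/2` of a Cover–Thomas symmetric channel. -/
def ctS (W : 𝓧 → 𝓨 → ℝ) : ℝ :=
  (ctMoment W 3 / ctV W ^ ((3 : ℝ) / 2)) * Real.sqrt (ctV W) / 6 + 1 / 2

/-- Non-Gaussianity of a Cover–Thomas symmetric channel. -/
def ctZeta (W : 𝓧 → 𝓨 → ℝ) (n : ℕ) (e : ℝ) : ℝ :=
  Real.log (Mstar W n e) - ((n : ℝ) * capacity W - Real.sqrt ((n : ℝ) * ctV W) * gaussQinv e)

/-! ### The Gaussian tail -/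

/-- The standard Gaussian density. -/
def gaussPhi (t : ℝ) : ℝ := (Real.sqrt (2 * Real.pi))⁻¹ * Real.exp (-t ^ 2 / 2)

lemma gaussPhi_pos (t : ℝ) : 0 < gaussPhi t := by
  unfold gaussPhi; positivity

lemma gaussPhi_const_le_one : (Real.sqrt (2 * Real.pi))⁻¹ ≤ 1 := by
  apply inv_le_one_of_one_le₀
  rw [Real.one_le_sqrt]
  nlinarith [Real.pi_gt_three]

lemma gaussPhi_le_exp (t : ℝ) : gaussPhi t ≤ Real.exp (-t ^ 2 / 2) := by
  unfold gaussPhi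
  exact mul_le_of_le_one_left (Real.exp_pos _).le gaussPhi_const_le_one

lemma gaussPhi_le_one (t : ℝ) : gaussPhi t ≤ 1 :=
  (gaussPhi_le_exp t).trans (Real.exp_le_one_iff.2 (by nlinarith [sq_nonneg t]))

lemma gaussPhi_neg (t : ℝ) : gaussPhi (-t) = gaussPhi t := by
  simp [gaussPhi]

lemma gaussPhi_anti_abs {s t : ℝ} (h : |s| ≤ |t|) : gaussPhi t ≤ gaussPhi s := by
  unfold gaussPhi
  have := sq_le_sq.2 h
  gcongr

lemma hasDerivAt_gaussPhi (t : ℝ) : HasDerivAt gaussPhi (-t * gaussPhi t) t := by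
  have h : HasDerivAt (fun t : ℝ => -t ^ 2 / 2) (-t) t := by
    have := ((hasDerivAt_pow 2 t).neg).div_const 2
    convert! this using 1
    simp only [Nat.cast_ofNat, Nat.add_one_sub_one, pow_one]
    ring
  have := (h.exp).const_mul ((Real.sqrt (2 * Real.pi))⁻¹)
  convert! this using 1
  unfold gaussPhi; ring

lemma continuous_gaussPhi : Continuous gaussPhi := by
  unfold gaussPhi; fun_prop

lemma integrable_gaussPhi : Integrable gaussPhi := by
  have := (integrable_exp_neg_mul_sq (b := 1 / 2) (by norm_num)).const_mul
    ((Real.sqrt (2 * Real.pi))⁻¹)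
  have h : gaussPhi
      = fun t => (Real.sqrt (2 * Real.pi))⁻¹ * Real.exp (-(1 / 2) * t ^ 2) := by
    funext t; unfold gaussPhi; congr 2; ring
  rwa [h]

lemma integral_gaussPhi : ∫ t, gaussPhi t = 1 := by
  have h := integral_gaussian (1 / 2)
  have h2 : ∀ t : ℝ, gaussPhi t = (Real.sqrt (2 * Real.pi))⁻¹ * Real.exp (-(1 / 2) * t ^ 2) := by
    intro t; unfold gaussPhi; congr 2; ring
  simp_rw [h2]
  rw [integral_const_mul, h]
  have : Real.pi / (1 / 2) = 2 * Real.pi := by ring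
  rw [this]
  exact inv_mul_cancel₀ (by positivity)

lemma gaussQ_eq (x : ℝ) : gaussQ x = ∫ t in Set.Ioi x, gaussPhi t := rfl

lemma hasDerivAt_integral_Ioi {g : ℝ → ℝ} (hg : Continuous g) (hi : Integrable g) (x : ℝ) :
    HasDerivAt (fun x => ∫ t in Set.Ioi x, g t) (-g x) x := by
  have h : ∀ y, ∫ t in Set.Ioi y, g t = (∫ t in Set.Ioi 0, g t) - ∫ t in (0 : ℝ)..y, g t := by
    intro y
    rw [← intervalIntegral.integral_interval_add_Ioi (a := 0) (b := y) hi.integrableOn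
      hi.integrableOn]
    ring
  have h2 : HasDerivAt (fun y => ∫ t in (0 : ℝ)..y, g t) (g x) x :=
    intervalIntegral.integral_hasDerivAt_right (hg.intervalIntegrable _ _)
      hg.stronglyMeasurable.stronglyMeasurableAtFilter hg.continuousAt
  have h3 := h2.const_sub (∫ t in Set.Ioi 0, g t)
  refine h3.congr_of_eventuallyEq (Eventually.of_forall h)

lemma hasDerivAt_gaussQ (x : ℝ) : HasDerivAt gaussQ (-gaussPhi x) x :=
  hasDerivAt_integral_Ioi continuous_gaussPhi integrable_gaussPhi x

lemma continuous_gaussQ : Continuous gaussQ :=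
  continuous_iff_continuousAt.2 fun x => (hasDerivAt_gaussQ x).continuousAt

lemma strictAnti_gaussQ : StrictAnti gaussQ :=
  strictAnti_of_deriv_neg fun x => by
    rw [(hasDerivAt_gaussQ x).deriv]; linarith [gaussPhi_pos x]

lemma gaussQ_neg (x : ℝ) : gaussQ (-x) = 1 - gaussQ x := by
  have h1 := intervalIntegral.integral_Iic_add_Ioi (b := x) integrable_gaussPhi.integrableOn
    integrable_gaussPhi.integrableOn
  have h2 : ∫ t in Set.Iic x, gaussPhi t = ∫ t in Set.Ioi (-x), gaussPhi t := by
    rw [← integral_comp_neg_Iic]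
    simp_rw [gaussPhi_neg]
  rw [integral_gaussPhi, h2, ← gaussQ_eq, ← gaussQ_eq] at h1
  linarith

lemma gaussQ_zero : gaussQ 0 = 1 / 2 := by
  have := gaussQ_neg 0
  simp only [neg_zero] at this
  linarith

lemma tendsto_gaussQ_atTop : Tendsto gaussQ atTop (nhds 0) :=
  tendsto_integral_Ioi_zero tendsto_id

lemma tendsto_gaussQ_atBot : Tendsto gaussQ atBot (nhds 1) := by
  have h := (tendsto_gaussQ_atTop.comp tendsto_neg_atBot_atTop).const_sub 1
  rw [sub_zero] at h
  refine h.congr fun x => ?_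
  simp [gaussQ_neg]

lemma gaussQ_nonneg (x : ℝ) : 0 ≤ gaussQ x :=
  integral_nonneg fun t => (gaussPhi_pos t).le

lemma gaussQ_le_one (x : ℝ) : gaussQ x ≤ 1 := by
  have := gaussQ_nonneg (-x)
  rw [gaussQ_neg] at this
  linarith

lemma gaussQ_gaussQinv {e : ℝ} (he : e ∈ Set.Ioo (0 : ℝ) 1) : gaussQ (gaussQinv e) = e := by
  apply Function.invFun_eq
  obtain ⟨a, ha⟩ := (tendsto_gaussQ_atTop.eventually (gt_mem_nhds he.1)).exists
  obtain ⟨b, hb⟩ := (tendsto_gaussQ_atBot.eventually (lt_mem_nhds he.2)).exists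
  obtain ⟨x, hx⟩ := mem_range_of_exists_le_of_exists_ge continuous_gaussQ ⟨a, ha.le⟩ ⟨b, hb.le⟩
  exact ⟨x, hx⟩

lemma nonneg_of_antitoneOn_of_tendsto {f f' : ℝ → ℝ}
    (hd : ∀ x, 0 < x → HasDerivAt f (f' x) x) (hn : ∀ x, 0 < x → f' x ≤ 0)
    (hl : Tendsto f atTop (nhds 0)) {x : ℝ} (hx : 0 < x) : 0 ≤ f x := by
  have ha : AntitoneOn f (Set.Ioi 0) := by
    apply antitoneOn_of_deriv_nonpos (convex_Ioi 0)
    · exact fun y hy => (hd y hy).continuousAt.continuousWithinAt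
    · intro y hy
      rw [interior_Ioi] at hy
      exact (hd y hy).differentiableAt.differentiableWithinAt
    · intro y hy
      rw [interior_Ioi] at hy
      rw [(hd y hy).deriv]; exact hn y hy
  refine le_of_tendsto hl ?_
  filter_upwards [eventually_ge_atTop x] with y hy
  exact ha hx (lt_of_lt_of_le hx hy) hy

lemma tendsto_gaussPhi_div : Tendsto (fun x => gaussPhi x / x) atTop (nhds 0) := by
  refine squeeze_zero' ?_ ?_ (tendsto_inv_atTop_zero (𝕜 := ℝ))
  · filter_upwards [eventually_gt_atTop 0] with x hx
    exact div_nonneg (gaussPhi_pos x).le hx.le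
  · filter_upwards [eventually_gt_atTop 0] with x hx
    rw [div_eq_mul_inv]
    exact mul_le_of_le_one_left (by positivity) (gaussPhi_le_one x)

lemma gaussQ_le_div {x : ℝ} (hx : 0 < x) : gaussQ x ≤ gaussPhi x / x := by
  have := nonneg_of_antitoneOn_of_tendsto (f := fun x => gaussPhi x / x - gaussQ x)
    (f' := fun x => (-x * gaussPhi x * x - gaussPhi x * 1) / x ^ 2 - -gaussPhi x)
    (fun x hx => ((hasDerivAt_gaussPhi x).div (hasDerivAt_id x) hx.ne').sub (hasDerivAt_gaussQ x))
    (fun x hx => by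
      have h : (-x * gaussPhi x * x - gaussPhi x * 1) / x ^ 2 - -gaussPhi x
        = - (gaussPhi x / x ^ 2) := by field_simp; ring
      rw [h]
      have := gaussPhi_pos x
      simp only [Left.neg_nonpos_iff]; positivity)
    (by simpa using tendsto_gaussPhi_div.sub tendsto_gaussQ_atTop) hx
  linarith

lemma le_gaussQ {x : ℝ} (hx : 0 < x) : gaussPhi x / x - gaussPhi x / x ^ 3 ≤ gaussQ x := by
  have := nonneg_of_antitoneOn_of_tendsto
    (f := fun x => gaussQ x - (gaussPhi x / x - gaussPhi x / x ^ 3))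
    (f' := fun x => -gaussPhi x - ((-x * gaussPhi x * x - gaussPhi x * 1) / x ^ 2
      - (-x * gaussPhi x * x ^ 3 - gaussPhi x * ((3 : ℕ) * x ^ (3 - 1))) / (x ^ 3) ^ 2))
    (fun x hx => (hasDerivAt_gaussQ x).sub
      (((hasDerivAt_gaussPhi x).div (hasDerivAt_id x) hx.ne').sub
        ((hasDerivAt_gaussPhi x).div (hasDerivAt_pow 3 x) (by positivity))))
    (fun x hx => by
      have h : -gaussPhi x - ((-x * gaussPhi x * x - gaussPhi x * 1) / x ^ 2
        - (-x * gaussPhi x * x ^ 3 - gaussPhi x * ((3 : ℕ) * x ^ (3 - 1))) / (x ^ 3) ^ 2)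
        = - (3 * gaussPhi x / x ^ 4) := by field_simp; push_cast; ring
      rw [h]
      have := gaussPhi_pos x
      simp only [Left.neg_nonpos_iff]; positivity)
    (by
      have h2 : Tendsto (fun x => gaussPhi x / x ^ 3) atTop (nhds 0) := by
        refine squeeze_zero' ?_ ?_ tendsto_gaussPhi_div
        · filter_upwards [eventually_gt_atTop 0] with x hx
          exact div_nonneg (gaussPhi_pos x).le (by positivity)
        · filter_upwards [eventually_ge_atTop 1] with x hx
          have := gaussPhi_pos x
          have h3 : x ≤ x ^ 3 := by nlinarith [sq_nonneg x]
          gcongr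
      simpa using tendsto_gaussQ_atTop.sub (tendsto_gaussPhi_div.sub h2)) hx
  linarith

lemma gaussQ_le_exp {x : ℝ} (hx : 1 ≤ x) : gaussQ x ≤ Real.exp (-x ^ 2 / 2) := by
  refine (gaussQ_le_div (by linarith)).trans ?_
  refine (div_le_self (gaussPhi_pos x).le hx).trans (gaussPhi_le_exp x)

lemma exists_gaussQ_sub (a b : ℝ) (hab : a < b) :
    ∃ c ∈ Set.Ioo a b, gaussQ a - gaussQ b = gaussPhi c * (b - a) := by
  obtain ⟨c, hc, h⟩ := exists_hasDerivAt_eq_slope gaussQ (fun x => -gaussPhi x) hab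
    continuous_gaussQ.continuousOn (fun x _ => hasDerivAt_gaussQ x)
  refine ⟨c, hc, ?_⟩
  have : b - a ≠ 0 := by linarith
  field_simp at h
  linarith

lemma gaussQ_sub_le {a b : ℝ} (hab : a ≤ b) : gaussQ a - gaussQ b ≤ b - a := by
  rcases hab.eq_or_lt with rfl | h
  · simp
  obtain ⟨c, _, hc⟩ := exists_gaussQ_sub a b h
  rw [hc]
  exact mul_le_of_le_one_left (by linarith) (gaussPhi_le_one c)

lemma le_gaussQ_sub {a b : ℝ} (hab : a ≤ b) (ha : -1 ≤ a) (hb : b ≤ 1) :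
    gaussPhi 1 * (b - a) ≤ gaussQ a - gaussQ b := by
  rcases hab.eq_or_lt with rfl | h
  · simp
  obtain ⟨c, hc, h⟩ := exists_gaussQ_sub a b h
  rw [h]
  refine mul_le_mul_of_nonneg_right (gaussPhi_anti_abs ?_) (by linarith)
  rw [abs_one, abs_le]
  exact ⟨by linarith [hc.1], by linarith [hc.2]⟩

/-- The (normalized) Mills ratio. -/
def mills (t : ℝ) : ℝ := Real.exp (t ^ 2 / 2) * gaussQ t

lemma gaussQ_eq_mills (t : ℝ) : gaussQ t = Real.exp (-t ^ 2 / 2) * mills t := by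
  unfold mills
  rw [← mul_assoc, ← Real.exp_add]
  have : -t ^ 2 / 2 + t ^ 2 / 2 = 0 := by ring
  simp [this]

lemma exp_mul_gaussPhi (t : ℝ) :
    Real.exp (t ^ 2 / 2) * gaussPhi t = (Real.sqrt (2 * Real.pi))⁻¹ := by
  unfold gaussPhi
  rw [mul_left_comm, ← Real.exp_add]
  have : t ^ 2 / 2 + -t ^ 2 / 2 = 0 := by ring
  simp [this]

lemma hasDerivAt_mills (t : ℝ) :
    HasDerivAt mills (t * mills t - (Real.sqrt (2 * Real.pi))⁻¹) t := by
  have h : HasDerivAt (fun t : ℝ => t ^ 2 / 2) t t := by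
    have := ((hasDerivAt_pow 2 t)).div_const 2
    convert! this using 1
    simp
  have := h.exp.mul (hasDerivAt_gaussQ t)
  convert! this using 1
  rw [← exp_mul_gaussPhi t]
  unfold mills; ring

lemma abs_deriv_mills_le {t : ℝ} (ht : 0 < t) :
    |t * mills t - (Real.sqrt (2 * Real.pi))⁻¹| ≤ 1 / t ^ 2 := by
  have h1 := gaussQ_le_div ht
  have h2 := le_gaussQ ht
  have e := exp_mul_gaussPhi t
  have e1 := gaussPhi_const_le_one
  have p := Real.exp_pos (t ^ 2 / 2)
  set k := (Real.sqrt (2 * Real.pi))⁻¹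
  have m1 : t * mills t ≤ k := by
    unfold mills
    calc t * (Real.exp (t ^ 2 / 2) * gaussQ t)
        ≤ t * (Real.exp (t ^ 2 / 2) * (gaussPhi t / t)) := by gcongr
      _ = k := by rw [← e]; field_simp
  have m2 : k - k / t ^ 2 ≤ t * mills t := by
    unfold mills
    calc k - k / t ^ 2 = t * (Real.exp (t ^ 2 / 2) * (gaussPhi t / t - gaussPhi t / t ^ 3)) := by
          rw [← e]; field_simp
      _ ≤ _ := by gcongr
  have m3 : k / t ^ 2 ≤ 1 / t ^ 2 := by gcongr
  rw [abs_le]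
  constructor
  · linarith
  · have : 0 ≤ 1 / t ^ 2 := by positivity
    linarith

lemma abs_mills_sub_le {m u x : ℝ} (hm : 0 < m) (hu : m ≤ u) (hx : m ≤ x) :
    |mills u - mills x| ≤ |u - x| / m ^ 2 := by
  have := Convex.norm_image_sub_le_of_norm_hasDerivWithin_le (f := mills)
    (f' := fun t => t * mills t - (Real.sqrt (2 * Real.pi))⁻¹) (s := Set.Ici m) (C := 1 / m ^ 2)
    (x := x) (y := u)
    (fun t _ => (hasDerivAt_mills t).hasDerivWithinAt)
    (fun t ht => by
      have ht' : m ≤ t := ht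
      refine (abs_deriv_mills_le (lt_of_lt_of_le hm ht)).trans ?_
      gcongr) (convex_Ici m) hx hu
  rw [Real.norm_eq_abs, Real.norm_eq_abs] at this
  calc _ ≤ _ := this
    _ = _ := by ring

/-! ### Expectations of sums of i.i.d. finitely supported variables -/

section IID

variable {α : Type*} [Fintype α]

/-- Expectation of `f (z(Y₁) + ⋯ + z(Yₙ))` where the `Yᵢ` are i.i.d. with weights `p`. -/
def iidE (p z : α → ℝ) (n : ℕ) (f : ℝ → ℝ) : ℝ :=
  ∑ y : Fin n → α, (∏ i, p (y i)) * f (∑ i, z (y i))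

lemma iidE_zero (p z : α → ℝ) (f : ℝ → ℝ) : iidE p z 0 f = f 0 := by
  simp [iidE]

lemma iidE_succ (p z : α → ℝ) (n : ℕ) (f : ℝ → ℝ) :
    iidE p z (n + 1) f = ∑ a, p a * iidE p z n (fun s => f (s + z a)) := by
  unfold iidE
  rw [← (Fin.consEquiv fun _ : Fin (n + 1) => α).sum_comp, Fintype.sum_prod_type]
  refine Finset.sum_congr rfl fun a _ => ?_
  rw [Finset.mul_sum]
  refine Finset.sum_congr rfl fun y _ => ?_
  simp only [Fin.consEquiv, Equiv.coe_fn_mk, Fin.prod_univ_succ, Fin.sum_univ_succ, Fin.cons_zero,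
    Fin.cons_succ]
  rw [add_comm (z a), mul_assoc]

lemma iidE_add (p z : α → ℝ) (n : ℕ) (f g : ℝ → ℝ) :
    iidE p z n (fun s => f s + g s) = iidE p z n f + iidE p z n g := by
  simp [iidE, mul_add, Finset.sum_add_distrib]

lemma iidE_sub (p z : α → ℝ) (n : ℕ) (f g : ℝ → ℝ) :
    iidE p z n (fun s => f s - g s) = iidE p z n f - iidE p z n g := by
  simp [iidE, mul_sub, Finset.sum_sub_distrib]

lemma iidE_mul (p z : α → ℝ) (n : ℕ) (c : ℝ) (f : ℝ → ℝ) :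
    iidE p z n (fun s => c * f s) = c * iidE p z n f := by
  simp only [iidE, Finset.mul_sum]
  exact Finset.sum_congr rfl fun y _ => by ring

lemma iidE_const {p : α → ℝ} (h1 : ∑ a, p a = 1) (z : α → ℝ) (n : ℕ) (c : ℝ) :
    iidE p z n (fun _ => c) = c := by
  induction n with
  | zero => exact iidE_zero ..
  | succ n ih => rw [iidE_succ]; simp only [ih, ← Finset.sum_mul, h1, one_mul]

lemma iidE_mono {p : α → ℝ} (hp : ∀ a, 0 ≤ p a) (z : α → ℝ) (n : ℕ) {f g : ℝ → ℝ}
    (h : ∀ s, f s ≤ g s) : iidE p z n f ≤ iidE p z n g :=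
  Finset.sum_le_sum fun _ _ =>
    mul_le_mul_of_nonneg_left (h _) (Finset.prod_nonneg fun _ _ => hp _)

lemma iidE_nonneg {p : α → ℝ} (hp : ∀ a, 0 ≤ p a) (z : α → ℝ) (n : ℕ) {f : ℝ → ℝ}
    (h : ∀ s, 0 ≤ f s) : 0 ≤ iidE p z n f :=
  Finset.sum_nonneg fun _ _ => mul_nonneg (Finset.prod_nonneg fun _ _ => hp _) (h _)

lemma abs_iidE_sub_le {p : α → ℝ} (hp : ∀ a, 0 ≤ p a) (z : α → ℝ) (n : ℕ) {f g r : ℝ → ℝ}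
    (h : ∀ s, |f s - g s| ≤ r s) : |iidE p z n f - iidE p z n g| ≤ iidE p z n r := by
  rw [← iidE_sub]
  refine (Finset.abs_sum_le_sum_abs _ _).trans (Finset.sum_le_sum fun y _ => ?_)
  have hy : 0 ≤ ∏ i, p (y i) := Finset.prod_nonneg fun _ _ => hp _
  rw [abs_mul, abs_of_nonneg hy]
  exact mul_le_mul_of_nonneg_left (h _) hy

lemma iidE_smul (p z : α → ℝ) (n : ℕ) (c : ℝ) (f : ℝ → ℝ) :
    iidE p (fun a => c * z a) n f = iidE p z n (fun s => f (c * s)) := by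
  simp [iidE, Finset.mul_sum]

lemma iidE_shift (p z : α → ℝ) (n : ℕ) (c : ℝ) (f : ℝ → ℝ) :
    iidE p (fun a => z a - c) n f = iidE p z n (fun s => f (s - n * c)) := by
  simp [iidE, Finset.sum_sub_distrib]

lemma iidE_tilt {p z : α → ℝ} {θ m : ℝ} (hm : m ≠ 0) (n : ℕ) (f : ℝ → ℝ) :
    iidE (fun a => p a * Real.exp (θ * z a) / m) z n f
      = (m ^ n)⁻¹ * iidE p z n (fun s => Real.exp (θ * s) * f s) := by
  simp only [iidE, Finset.mul_sum]
  refine Finset.sum_congr rfl fun y _ => ?_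
  rw [Finset.prod_div_distrib, Finset.prod_mul_distrib, Finset.prod_const, Real.exp_sum]
  simp only [Finset.card_univ, Fintype.card_fin]
  field_simp

lemma integral_iidE {μ : Measure ℝ} (p z : α → ℝ) (n : ℕ) {f : ℝ → ℝ → ℝ}
    (h : ∀ s, Integrable (fun v => f v s) μ) :
    ∫ v, iidE p z n (f v) ∂μ = iidE p z n (fun s => ∫ v, f v s ∂μ) := by
  unfold iidE
  rw [integral_finsetSum _ fun y _ => (h _).const_mul _]
  simp_rw [integral_const_mul]

lemma integrable_iidE {μ : Measure ℝ} (p z : α → ℝ) (n : ℕ) {f : ℝ → ℝ → ℝ}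
    (h : ∀ s, Integrable (fun v => f v s) μ) :
    Integrable (fun v => iidE p z n (f v)) μ := by
  unfold iidE
  exact integrable_finsetSum _ fun y _ => (h _).const_mul _

lemma iidE_succ_mul_self (p z : α → ℝ) (n : ℕ) (f : ℝ → ℝ) :
    iidE p z (n + 1) (fun s => s * f s)
      = (n + 1) * ∑ a, p a * z a * iidE p z n (fun s => f (s + z a)) := by
  induction n generalizing f with
  | zero =>
    rw [iidE_succ]
    simp [iidE_zero, mul_assoc]
  | succ n ih =>
    rw [iidE_succ]
    have hs : ∀ a, iidE p z (n + 1) (fun s => (s + z a) * f (s + z a))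
        = iidE p z (n + 1) (fun s => s * f (s + z a))
          + z a * iidE p z (n + 1) (fun s => f (s + z a)) := by
      intro a
      rw [← iidE_mul, ← iidE_add]
      congr 1; funext s; ring
    simp_rw [hs, ih (fun s => f (s + z _)), mul_add, Finset.sum_add_distrib]
    have e : ∑ a, p a * ((n + 1) * ∑ b, p b * z b * iidE p z n (fun s => f (s + z b + z a)))
        = (n + 1) * ∑ b, p b * z b * iidE p z (n + 1) (fun s => f (s + z b)) := by
      simp_rw [iidE_succ, Finset.mul_sum]
      rw [Finset.sum_comm]
      refine Finset.sum_congr rfl fun b _ => Finset.sum_congr rfl fun a _ => ?_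
      have : (fun s => f (s + z b + z a)) = fun s => f (s + z a + z b) := by
        funext s; ring_nf
      rw [this]; ring
    rw [e]
    push_cast
    simp only [mul_assoc]
    ring

lemma iidE_sq {p z : α → ℝ} (h1 : ∑ a, p a = 1) (h0 : ∑ a, p a * z a = 0) (n : ℕ) :
    iidE p z n (fun s => s ^ 2) = n * ∑ a, p a * z a ^ 2 := by
  cases n with
  | zero => simp [iidE_zero]
  | succ n =>
    have := iidE_succ_mul_self p z n (fun s => s)
    simp_rw [iidE_add, iidE_const h1, mul_add, Finset.sum_add_distrib, ← Finset.sum_mul, h0] at this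
    simp only [← pow_two, zero_mul, zero_add] at this
    rw [this]
    push_cast
    congr 1
    exact Finset.sum_congr rfl fun a _ => by ring

/-- Distribution function of the sum. -/
def iidF (p z : α → ℝ) (n : ℕ) (t : ℝ) : ℝ := iidE p z n (fun s => if s ≤ t then 1 else 0)

lemma iidF_nonneg {p : α → ℝ} (hp : ∀ a, 0 ≤ p a) (z : α → ℝ) (n : ℕ) (t : ℝ) :
    0 ≤ iidF p z n t :=
  iidE_nonneg hp z n fun s => by split_ifs <;> norm_num

lemma iidF_le_one {p : α → ℝ} (hp : ∀ a, 0 ≤ p a) (h1 : ∑ a, p a = 1) (z : α → ℝ) (n : ℕ)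
    (t : ℝ) : iidF p z n t ≤ 1 := by
  rw [← iidE_const h1 z n 1]
  exact iidE_mono hp z n fun s => by split_ifs <;> norm_num

lemma iidE_window (p z : α → ℝ) (n : ℕ) {a b : ℝ} (hab : a ≤ b) :
    iidE p z n (fun s => if a < s ∧ s ≤ b then 1 else 0) = iidF p z n b - iidF p z n a := by
  unfold iidF
  rw [← iidE_sub]
  congr 1; funext s
  by_cases h1 : s ≤ a
  · simp [h1, h1.trans hab, not_lt.2 h1]
  · simp [h1, not_le.1 h1]

lemma iidE_gt {p : α → ℝ} (h1 : ∑ a, p a = 1) (z : α → ℝ) (n : ℕ) (t : ℝ) :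
    iidE p z n (fun s => if t < s then 1 else 0) = 1 - iidF p z n t := by
  have h := iidE_sub p z n (fun _ => 1) (fun s => if s ≤ t then 1 else 0)
  rw [iidE_const h1] at h
  unfold iidF
  rw [← h]
  congr 1; funext s
  by_cases h : s ≤ t
  · simp [h, not_lt.2 h]
  · simp [h, not_le.1 h]

end IID

/-! ### Stein's method and the Berry–Esseen bound for bounded summands -/

lemma integral_Iic_gaussPhi (x : ℝ) : ∫ t in Set.Iic x, gaussPhi t = 1 - gaussQ x := by
  have h1 := intervalIntegral.integral_Iic_add_Ioi (b := x) integrable_gaussPhi.integrableOn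
    integrable_gaussPhi.integrableOn
  rw [integral_gaussPhi, ← gaussQ_eq] at h1
  linarith

lemma gaussQ_abs_div_le (w : ℝ) : gaussQ |w| / gaussPhi w ≤ (gaussPhi 1)⁻¹ := by
  have p1 := gaussPhi_pos 1
  have pw := gaussPhi_pos w
  have pa : gaussPhi |w| = gaussPhi w := by simp [gaussPhi]
  rcases le_total |w| 1 with h | h
  · rw [div_le_iff₀ pw]
    have : gaussPhi 1 ≤ gaussPhi w := gaussPhi_anti_abs (by simpa using h)
    calc gaussQ |w| ≤ 1 := gaussQ_le_one _
      _ = (gaussPhi 1)⁻¹ * gaussPhi 1 := by field_simp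
      _ ≤ _ := by gcongr
  · have h2 := gaussQ_le_div (x := |w|) (by linarith)
    rw [pa] at h2
    calc gaussQ |w| / gaussPhi w ≤ (gaussPhi w / |w|) / gaussPhi w := by gcongr
      _ = 1 / |w| := by field_simp
      _ ≤ 1 := by rw [div_le_one (by linarith)]; exact h
      _ ≤ _ := (one_le_inv₀ p1).2 (gaussPhi_le_one 1)

lemma abs_mul_gaussQ_div_le (w : ℝ) : |w| * (gaussQ |w| / gaussPhi w) ≤ 1 := by
  have pw := gaussPhi_pos w
  have pa : gaussPhi |w| = gaussPhi w := by simp [gaussPhi]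
  rcases eq_or_ne w 0 with rfl | h
  · simp
  · have hw : 0 < |w| := abs_pos.2 h
    have h2 := gaussQ_le_div hw
    rw [pa] at h2
    calc |w| * (gaussQ |w| / gaussPhi w) ≤ |w| * ((gaussPhi w / |w|) / gaussPhi w) := by gcongr
      _ = 1 := by field_simp

lemma exists_stein_solution {h : ℝ → ℝ} (hc : Continuous h) (h0 : ∀ t, 0 ≤ h t)
    (h1 : ∀ t, h t ≤ 1) :
    ∃ f : ℝ → ℝ, (∀ w, HasDerivAt f (w * f w + (h w - ∫ t, h t * gaussPhi t)) w) ∧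
      (∀ w, |f w| ≤ (gaussPhi 1)⁻¹) ∧ ∀ w, |w * f w| ≤ 1 := by
  set N := ∫ t, h t * gaussPhi t with hN
  have hi : Integrable (fun t => h t * gaussPhi t) := by
    refine integrable_gaussPhi.bdd_mul (c := 1) hc.aestronglyMeasurable ?_
    exact Eventually.of_forall fun t => by
      rw [Real.norm_eq_abs, abs_of_nonneg (h0 t)]; exact h1 t
  have N0 : 0 ≤ N := integral_nonneg fun t => mul_nonneg (h0 t) (gaussPhi_pos t).le
  have N1 : N ≤ 1 := by
    rw [← integral_gaussPhi]
    exact integral_mono hi integrable_gaussPhi fun t =>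
      mul_le_of_le_one_left (gaussPhi_pos t).le (h1 t)
  have gb : ∀ t, |h t - N| ≤ 1 := fun t => abs_le.2 ⟨by linarith [h0 t], by linarith [h1 t]⟩
  have gi : Integrable (fun t => (h t - N) * gaussPhi t) := by
    simp_rw [sub_mul]
    exact hi.sub (integrable_gaussPhi.const_mul N)
  have g0 : ∫ t, (h t - N) * gaussPhi t = 0 := by
    simp_rw [sub_mul]
    rw [integral_sub hi (integrable_gaussPhi.const_mul N), integral_const_mul, integral_gaussPhi,
      ← hN]
    ring
  set H : ℝ → ℝ := fun w => ∫ t in Set.Ioi w, (h t - N) * gaussPhi t with hH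
  have gle : ∀ t, ‖(h t - N) * gaussPhi t‖ ≤ gaussPhi t := fun t => by
    rw [Real.norm_eq_abs, abs_mul, abs_of_pos (gaussPhi_pos t)]
    exact mul_le_of_le_one_left (gaussPhi_pos t).le (gb t)
  have Hb : ∀ w, |H w| ≤ gaussQ |w| := by
    intro w
    rcases le_total 0 w with hw | hw
    · rw [abs_of_nonneg hw, gaussQ_eq]
      exact norm_integral_le_of_norm_le integrable_gaussPhi.integrableOn
        (Eventually.of_forall gle)
    · have h2 := intervalIntegral.integral_Iic_add_Ioi (b := w) gi.integrableOn gi.integrableOn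
      rw [g0] at h2
      have h3 : H w = - ∫ t in Set.Iic w, (h t - N) * gaussPhi t := by
        rw [hH]; linarith
      rw [h3, abs_neg, abs_of_nonpos hw, gaussQ_neg, ← integral_Iic_gaussPhi]
      exact norm_integral_le_of_norm_le integrable_gaussPhi.integrableOn
        (Eventually.of_forall gle)
  have Hd : ∀ w, HasDerivAt H (-((h w - N) * gaussPhi w)) w := fun w =>
    hasDerivAt_integral_Ioi ((hc.sub continuous_const).mul continuous_gaussPhi) gi w
  have fb : ∀ w, |-(H w / gaussPhi w)| ≤ gaussQ |w| / gaussPhi w := fun w => by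
    have := gaussPhi_pos w
    rw [abs_neg, abs_div, abs_of_pos this]
    gcongr
    exact Hb w
  refine ⟨fun w => -(H w / gaussPhi w), fun w => ?_, fun w => ?_, fun w => ?_⟩
  · have := ((Hd w).div (hasDerivAt_gaussPhi w) (gaussPhi_pos w).ne').neg
    convert! this using 1
    have := (gaussPhi_pos w).ne'
    field_simp
    ring
  · exact (fb w).trans (gaussQ_abs_div_le w)
  · rw [abs_mul]
    exact (mul_le_mul_of_nonneg_left (fb w) (abs_nonneg w)).trans (abs_mul_gaussQ_div_le w)

section SteinIID

variable {α : Type*} [Fintype α]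

lemma abs_stein_identity_le {p ξ : α → ℝ} (hp : ∀ a, 0 ≤ p a) (h1 : ∑ a, p a = 1)
    (h0 : ∑ a, p a * ξ a = 0) (n : ℕ) (hv : (n + 1) * ∑ a, p a * ξ a ^ 2 = 1) {δ : ℝ}
    (hδ : ∀ a, |ξ a| ≤ δ) {f f' R : ℝ → ℝ} (hf : ∀ w, HasDerivAt f (f' w) w)
    (hR : ∀ w y, |y - w| ≤ δ → |f' y - f' w| ≤ R w) :
    |iidE p ξ (n + 1) (fun w => f' w - w * f w)| ≤ 2 * iidE p ξ n R := by
  have e1 : |iidE p ξ (n + 1) f' - iidE p ξ n f'| ≤ iidE p ξ n R := by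
    have : iidE p ξ (n + 1) f' - iidE p ξ n f'
        = ∑ a, p a * (iidE p ξ n (fun w => f' (w + ξ a)) - iidE p ξ n f') := by
      simp_rw [iidE_succ p ξ n, mul_sub, Finset.sum_sub_distrib, ← Finset.sum_mul, h1, one_mul]
    rw [this]
    calc _ ≤ ∑ a, p a * iidE p ξ n R := by
          refine (Finset.abs_sum_le_sum_abs _ _).trans (Finset.sum_le_sum fun a _ => ?_)
          rw [abs_mul, abs_of_nonneg (hp a)]
          refine mul_le_mul_of_nonneg_left (abs_iidE_sub_le hp ξ n fun w => hR w _ ?_) (hp a)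
          simpa using hδ a
      _ = _ := by rw [← Finset.sum_mul, h1, one_mul]
  have hfe : ∀ a w, |(f (w + ξ a) - f w) - ξ a * f' w| ≤ |ξ a| * R w := by
    intro a w
    have ha := hδ a
    have ha2 := abs_nonneg (ξ a)
    have := Convex.norm_image_sub_le_of_norm_hasDerivWithin_le (f := fun t => f t - t * f' w)
      (f' := fun t => f' t - 1 * f' w) (s := Set.Icc (w - δ) (w + δ)) (C := R w)
      (x := w) (y := w + ξ a)
      (fun t _ => ((hf t).sub ((hasDerivAt_id t).mul_const _)).hasDerivWithinAt)
      (fun t ht => by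
        rw [one_mul]
        exact hR w t (abs_le.2 ⟨by linarith [ht.1], by linarith [ht.2]⟩)) (convex_Icc _ _)
      ⟨by linarith, by linarith⟩ ⟨by linarith [(abs_le.1 ha).1], by linarith [(abs_le.1 ha).2]⟩
    rw [Real.norm_eq_abs, Real.norm_eq_abs] at this
    calc _ = |f (w + ξ a) - (w + ξ a) * f' w - (f w - w * f' w)| := by congr 1; ring
      _ ≤ _ := this
      _ = _ := by rw [add_sub_cancel_left, mul_comm]
  have e2 : |iidE p ξ (n + 1) (fun w => w * f w) - iidE p ξ n f'| ≤ iidE p ξ n R := by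
    have e3 : iidE p ξ (n + 1) (fun w => w * f w) - iidE p ξ n f'
        = (n + 1) * ∑ a, p a * ξ a * (iidE p ξ n (fun w => f (w + ξ a) - f w)
          - iidE p ξ n (fun w => ξ a * f' w)) := by
      rw [iidE_succ_mul_self]
      simp_rw [iidE_sub, iidE_mul, mul_sub, Finset.sum_sub_distrib, ← Finset.sum_mul, h0]
      have : ∑ a, p a * ξ a * (ξ a * iidE p ξ n f') = (∑ a, p a * ξ a ^ 2) * iidE p ξ n f' := by
        rw [Finset.sum_mul]
        exact Finset.sum_congr rfl fun a _ => by ring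
      rw [this, mul_sub, mul_sub, ← mul_assoc _ _ (iidE p ξ n f'), hv]
      ring
    rw [e3, abs_mul, abs_of_nonneg (by positivity)]
    calc _ ≤ (n + 1 : ℝ) * ∑ a, p a * ξ a ^ 2 * iidE p ξ n R := by
          gcongr
          refine (Finset.abs_sum_le_sum_abs _ _).trans (Finset.sum_le_sum fun a _ => ?_)
          rw [abs_mul, abs_mul, abs_of_nonneg (hp a), ← sq_abs, pow_two, mul_assoc, mul_assoc,
            mul_assoc, ← iidE_mul]
          have := hp a
          gcongr
          exact abs_iidE_sub_le hp ξ n fun w => hfe a w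
      _ = _ := by rw [← Finset.sum_mul, ← mul_assoc, hv, one_mul]
  rw [iidE_sub]
  rw [abs_le] at *
  constructor <;> linarith [e1.1, e1.2, e2.1, e2.2]

/-- A continuous piecewise linear approximation of the indicator of `(-∞, z]`. -/
def ramp (z η w : ℝ) : ℝ := max 0 (min 1 (1 - (w - z) / η))

lemma continuous_ramp (z η : ℝ) : Continuous (ramp z η) := by
  unfold ramp; fun_prop

lemma ramp_nonneg (z η w : ℝ) : 0 ≤ ramp z η w := le_max_left _ _

lemma ramp_le_one (z η w : ℝ) : ramp z η w ≤ 1 := max_le zero_le_one (min_le_left _ _)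

lemma ramp_of_le {z η w : ℝ} (hη : 0 < η) (h : w ≤ z) : ramp z η w = 1 := by
  unfold ramp
  have : (w - z) / η ≤ 0 := div_nonpos_of_nonpos_of_nonneg (by linarith) hη.le
  rw [min_eq_left (by linarith)]; simp

lemma ramp_of_ge {z η w : ℝ} (hη : 0 < η) (h : z + η ≤ w) : ramp z η w = 0 := by
  unfold ramp
  have : 1 ≤ (w - z) / η := by rw [le_div_iff₀ hη]; linarith
  rw [max_eq_left]
  exact (min_le_right _ _).trans (by linarith)

lemma abs_ramp_sub_le {z η δ w y : ℝ} (hη : 0 < η) (hδ : |y - w| ≤ δ) :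
    |ramp z η y - ramp z η w|
      ≤ δ / η * (if z - δ ≤ w ∧ w ≤ z + η + δ then 1 else 0) := by
  have hd := abs_le.1 hδ
  split_ifs with h
  · rw [mul_one]
    unfold ramp
    refine (abs_max_sub_max_le_max _ _ _ _).trans ?_
    refine max_le (by simpa using div_nonneg ((abs_nonneg _).trans hδ) hη.le) ?_
    refine (abs_min_sub_min_le_max _ _ _ _).trans ?_
    refine max_le (by simpa using div_nonneg ((abs_nonneg _).trans hδ) hη.le) ?_
    have : 1 - (y - z) / η - (1 - (w - z) / η) = -((y - w) / η) := by ring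
    rw [this, abs_neg, abs_div, abs_of_pos hη]
    gcongr
  · rw [not_and_or, not_le, not_le] at h
    rcases h with h | h
    · rw [ramp_of_le hη (by linarith), ramp_of_le hη (by linarith)]; simp
    · rw [ramp_of_ge hη (by linarith), ramp_of_ge hη (by linarith)]; simp

lemma integrable_ramp_mul (z η : ℝ) : Integrable (fun t => ramp z η t * gaussPhi t) := by
  refine integrable_gaussPhi.bdd_mul (c := 1) (continuous_ramp z η).aestronglyMeasurable ?_
  exact Eventually.of_forall fun t => by
    rw [Real.norm_eq_abs, abs_of_nonneg (ramp_nonneg _ _ _)]; exact ramp_le_one _ _ _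

lemma le_integral_ramp {z η : ℝ} (hη : 0 < η) :
    1 - gaussQ z ≤ ∫ t, ramp z η t * gaussPhi t := by
  rw [← integral_Iic_gaussPhi, ← integral_indicator measurableSet_Iic]
  refine integral_mono (integrable_gaussPhi.indicator measurableSet_Iic)
    (integrable_ramp_mul z η) fun t => ?_
  by_cases h : t ≤ z
  · simp [Set.indicator, h, ramp_of_le hη h]
  · simp only [Set.indicator, Set.mem_Iic, h, if_false]
    exact mul_nonneg (ramp_nonneg _ _ _) (gaussPhi_pos t).le

lemma integral_ramp_le {z η : ℝ} (hη : 0 < η) :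
    ∫ t, ramp z η t * gaussPhi t ≤ 1 - gaussQ (z + η) := by
  rw [← integral_Iic_gaussPhi, ← integral_indicator measurableSet_Iic]
  refine integral_mono (integrable_ramp_mul z η)
    (integrable_gaussPhi.indicator measurableSet_Iic) fun t => ?_
  by_cases h : t ≤ z + η
  · simp only [Set.indicator, Set.mem_Iic, h, if_true]
    exact mul_le_of_le_one_left (gaussPhi_pos t).le (ramp_le_one _ _ _)
  · simp [Set.indicator, h, ramp_of_ge hη (not_le.1 h).le]

end SteinIID

section BerryEsseen

variable {α : Type*} [Fintype α]

/-- The constant of the Berry–Esseen bound for bounded summands. -/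
def berryEsseenConst : ℝ := 4 * (gaussPhi 1)⁻¹ + 40

lemma one_le_berryEsseenConst : 1 ≤ berryEsseenConst := by
  have := gaussPhi_pos 1
  unfold berryEsseenConst
  have : 0 < (gaussPhi 1)⁻¹ := by positivity
  linarith

lemma iidE_abs_le_one {p ξ : α → ℝ} (hp : ∀ a, 0 ≤ p a) (h1 : ∑ a, p a = 1)
    (h0 : ∑ a, p a * ξ a = 0) (n : ℕ) (hv : (n + 1) * ∑ a, p a * ξ a ^ 2 = 1) :
    iidE p ξ n (fun w => |w|) ≤ 1 := by
  have h : iidE p ξ n (fun w => |w|) ≤ iidE p ξ n (fun w => 1 / 2 * (1 + w ^ 2)) :=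
    iidE_mono hp ξ n fun w => by
      have := sq_nonneg (|w| - 1)
      rw [sub_sq, sq_abs] at this
      linarith
  refine h.trans ?_
  rw [iidE_mul, iidE_add, iidE_const h1, iidE_sq h1 h0]
  have : 0 ≤ ∑ a, p a * ξ a ^ 2 := Finset.sum_nonneg fun a _ => mul_nonneg (hp a) (sq_nonneg _)
  linarith

lemma iidE_closed_window_le {p ξ : α → ℝ} (hp : ∀ a, 0 ≤ p a) (h1 : ∑ a, p a = 1) (n : ℕ)
    {δ : ℝ} (hδ0 : 0 < δ) (hδ : ∀ a, |ξ a| ≤ δ) {a b : ℝ} (hab : a ≤ b) :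
    iidE p ξ n (fun w => if a ≤ w ∧ w ≤ b then 1 else 0)
      ≤ iidF p ξ (n + 1) (b + δ) - iidF p ξ (n + 1) (a - 2 * δ) := by
  rw [← iidE_window p ξ (n + 1) (by linarith), iidE_succ]
  calc _ = ∑ c, p c * iidE p ξ n (fun w => if a ≤ w ∧ w ≤ b then 1 else 0) := by
        rw [← Finset.sum_mul, h1, one_mul]
    _ ≤ _ := by
      refine Finset.sum_le_sum fun c _ => mul_le_mul_of_nonneg_left ?_ (hp c)
      refine iidE_mono hp ξ n fun w => ?_
      have := abs_le.1 (hδ c)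
      by_cases h : a ≤ w ∧ w ≤ b
      · rw [if_pos h, if_pos ⟨by linarith [h.1], by linarith [h.2]⟩]
      · rw [if_neg h]
        split_ifs <;> norm_num

lemma abs_iidE_ramp_sub_le {p ξ : α → ℝ} (hp : ∀ a, 0 ≤ p a) (h1 : ∑ a, p a = 1)
    (h0 : ∑ a, p a * ξ a = 0) (n : ℕ) (hv : (n + 1) * ∑ a, p a * ξ a ^ 2 = 1) {δ D : ℝ}
    (hδ0 : 0 < δ) (hδ1 : δ ≤ 1) (hδ : ∀ a, |ξ a| ≤ δ)
    (hD : ∀ t, |iidF p ξ (n + 1) t - (1 - gaussQ t)| ≤ D) (z : ℝ) :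
    |iidE p ξ (n + 1) (ramp z (8 * δ)) - ∫ t, ramp z (8 * δ) t * gaussPhi t|
      ≤ D / 2 + δ * (2 * (gaussPhi 1)⁻¹ + 12) := by
  set c := (gaussPhi 1)⁻¹ with hc
  have hc0 : 0 < c := inv_pos.2 (gaussPhi_pos 1)
  have hη : 0 < 8 * δ := by linarith
  obtain ⟨f, hf, hfb, hwf⟩ := exists_stein_solution (continuous_ramp z (8 * δ))
    (ramp_nonneg z (8 * δ)) (ramp_le_one z (8 * δ))
  set N := ∫ t, ramp z (8 * δ) t * gaussPhi t with hN
  have N0 : 0 ≤ N := integral_nonneg fun t => mul_nonneg (ramp_nonneg _ _ t) (gaussPhi_pos t).le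
  have N1 : N ≤ 1 := (integral_ramp_le hη).trans (by linarith [gaussQ_nonneg (z + 8 * δ)])
  have key := abs_stein_identity_le hp h1 h0 n hv hδ hf
    (R := fun w => δ * (c + 2 * δ + 2 * |w|)
      + δ / (8 * δ) * (if z - δ ≤ w ∧ w ≤ z + 8 * δ + δ then 1 else 0)) (fun w y hwy => by
        have e : y * f y + (ramp z (8 * δ) y - N) - (w * f w + (ramp z (8 * δ) w - N))
            = (y * f y - w * f w) + (ramp z (8 * δ) y - ramp z (8 * δ) w) := by ring
        rw [e]
        refine (abs_add_le _ _).trans (add_le_add ?_ (abs_ramp_sub_le hη hwy))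
        have := Convex.norm_image_sub_le_of_norm_hasDerivWithin_le (f := fun t => t * f t)
          (f' := fun t => 1 * f t + t * (t * f t + (ramp z (8 * δ) t - N)))
          (s := Set.Icc (w - δ) (w + δ)) (C := c + 2 * δ + 2 * |w|) (x := w) (y := y)
          (fun t _ => ((hasDerivAt_id t).mul (hf t)).hasDerivWithinAt)
          (fun t ht => by
            rw [Real.norm_eq_abs]
            have ht2 : |t| ≤ |w| + δ := by
              have : |t - w| ≤ δ := abs_le.2 ⟨by linarith [ht.1], by linarith [ht.2]⟩
              have h3 := abs_add_le (t - w) w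
              rw [sub_add_cancel] at h3
              linarith
            have h4 : |t * f t + (ramp z (8 * δ) t - N)| ≤ 2 := by
              refine (abs_add_le _ _).trans ?_
              have : |ramp z (8 * δ) t - N| ≤ 1 :=
                abs_le.2 ⟨by linarith [ramp_nonneg z (8 * δ) t],
                  by linarith [ramp_le_one z (8 * δ) t]⟩
              linarith [hwf t]
            calc |1 * f t + t * (t * f t + (ramp z (8 * δ) t - N))|
                ≤ |f t| + |t| * |t * f t + (ramp z (8 * δ) t - N)| := by
                  rw [← abs_mul]
                  simpa using abs_add_le (f t) (t * (t * f t + (ramp z (8 * δ) t - N)))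
              _ ≤ c + (|w| + δ) * 2 := by
                  gcongr
                  exact hfb t
              _ = _ := by ring) (convex_Icc _ _)
          ⟨by linarith, by linarith⟩
          ⟨by linarith [(abs_le.1 hwy).1], by linarith [(abs_le.1 hwy).2]⟩
        rw [Real.norm_eq_abs, Real.norm_eq_abs] at this
        refine this.trans ?_
        rw [mul_comm]
        have := abs_nonneg w
        gcongr)
  have e1 : iidE p ξ (n + 1) (fun w => w * f w + (ramp z (8 * δ) w - N) - w * f w)
      = iidE p ξ (n + 1) (ramp z (8 * δ)) - N := by
    have := iidE_sub p ξ (n + 1) (ramp z (8 * δ)) (fun _ => N)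
    rw [iidE_const h1] at this
    rw [← this]
    congr 1; funext w; ring
  rw [e1] at key
  refine key.trans ?_
  rw [iidE_add, iidE_mul, iidE_mul, iidE_add, iidE_mul, iidE_const h1]
  have a1 := iidE_abs_le_one hp h1 h0 n hv
  have a2 := iidE_closed_window_le hp h1 n hδ0 hδ (a := z - δ) (b := z + 8 * δ + δ)
    (by linarith)
  have a3 := (abs_le.1 (hD (z + 8 * δ + δ + δ))).2
  have a4 := (abs_le.1 (hD (z - δ - 2 * δ))).1
  have a5 := gaussQ_sub_le (a := z - δ - 2 * δ) (b := z + 8 * δ + δ + δ) (by linarith)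
  have e2 : δ / (8 * δ) = 1 / 8 := by field_simp
  rw [e2]
  set X := iidE p ξ n fun w => |w|
  set Y := iidE p ξ n fun w => if z - δ ≤ w ∧ w ≤ z + 8 * δ + δ then 1 else 0
  have b1 : Y ≤ 13 * δ + 2 * D := by linarith
  have b2 : δ * (c + 2 * δ + 2 * X) ≤ δ * (c + 2 * 1 + 2 * 1) := by gcongr
  nlinarith

lemma berry_esseen_normalized {p ξ : α → ℝ} (hp : ∀ a, 0 ≤ p a) (h1 : ∑ a, p a = 1)
    (h0 : ∑ a, p a * ξ a = 0) (n : ℕ) (hv : (n + 1) * ∑ a, p a * ξ a ^ 2 = 1) {δ : ℝ}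
    (hδ0 : 0 < δ) (hδ : ∀ a, |ξ a| ≤ δ) (t : ℝ) :
    |iidF p ξ (n + 1) t - (1 - gaussQ t)| ≤ berryEsseenConst * δ := by
  have hb : ∀ t, |iidF p ξ (n + 1) t - (1 - gaussQ t)| ≤ 1 := fun t => by
    have := iidF_nonneg hp ξ (n + 1) t
    have := iidF_le_one hp h1 ξ (n + 1) t
    have := gaussQ_nonneg t
    have := gaussQ_le_one t
    exact abs_le.2 ⟨by linarith, by linarith⟩
  have hc := one_le_berryEsseenConst
  rcases le_total δ 1 with hδ1 | hδ1
  swap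
  · exact (hb t).trans (by nlinarith)
  set D := ⨆ t, |iidF p ξ (n + 1) t - (1 - gaussQ t)| with hDdef
  have hD : ∀ t, |iidF p ξ (n + 1) t - (1 - gaussQ t)| ≤ D := fun t =>
    le_ciSup (f := fun t => |iidF p ξ (n + 1) t - (1 - gaussQ t)|)
      ⟨1, by rintro _ ⟨t, rfl⟩; exact hb t⟩ t
  have hη : 0 < 8 * δ := by linarith
  have main : D ≤ D / 2 + δ * (2 * (gaussPhi 1)⁻¹ + 12) + 8 * δ := by
    refine ciSup_le fun z => ?_
    have k1 := abs_le.1 (abs_iidE_ramp_sub_le hp h1 h0 n hv hδ0 hδ1 hδ hD z)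
    have k2 := abs_le.1 (abs_iidE_ramp_sub_le hp h1 h0 n hv hδ0 hδ1 hδ hD (z - 8 * δ))
    have l1 : iidF p ξ (n + 1) z ≤ iidE p ξ (n + 1) (ramp z (8 * δ)) :=
      iidE_mono hp ξ _ fun s => by
        split_ifs with h
        · rw [ramp_of_le hη h]
        · exact ramp_nonneg _ _ _
    have l2 : iidE p ξ (n + 1) (ramp (z - 8 * δ) (8 * δ)) ≤ iidF p ξ (n + 1) z :=
      iidE_mono hp ξ _ fun s => by
        split_ifs with h
        · exact ramp_le_one _ _ _
        · rw [ramp_of_ge hη (by linarith)]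
    have m1 := integral_ramp_le (z := z) hη
    have m2 := le_integral_ramp (z := z - 8 * δ) hη
    have g1 := gaussQ_sub_le (a := z) (b := z + 8 * δ) (by linarith)
    have g2 := gaussQ_sub_le (a := z - 8 * δ) (b := z) (by linarith)
    rw [abs_le]
    constructor <;> linarith [k1.2, k2.1]
  refine (hD t).trans ?_
  unfold berryEsseenConst
  nlinarith

/-- Berry–Esseen bound for sums of i.i.d. bounded centered variables. -/
theorem berry_esseen {p z : α → ℝ} (hp : ∀ a, 0 ≤ p a) (h1 : ∑ a, p a = 1)
    (h0 : ∑ a, p a * z a = 0) {v B : ℝ} (hv : ∑ a, p a * z a ^ 2 = v) (hv0 : 0 < v) (hB0 : 0 < B)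
    (hB : ∀ a, |z a| ≤ B) {n : ℕ} (hn : 0 < n) (t : ℝ) :
    |iidF p z n t - (1 - gaussQ (t / Real.sqrt (n * v)))|
      ≤ berryEsseenConst * B / Real.sqrt (n * v) := by
  obtain ⟨k, rfl⟩ : ∃ k, n = k + 1 := ⟨n - 1, by omega⟩
  have hnv : 0 < ((k + 1 : ℕ) : ℝ) * v := by positivity
  set τ := Real.sqrt ((k + 1 : ℕ) * v) with hτ
  have hτ0 : 0 < τ := Real.sqrt_pos.2 hnv
  have hτ2 : τ ^ 2 = (k + 1 : ℕ) * v := Real.sq_sqrt hnv.le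
  have key := berry_esseen_normalized (ξ := fun a => τ⁻¹ * z a) hp h1
    (by
      have : ∀ a, p a * (τ⁻¹ * z a) = τ⁻¹ * (p a * z a) := fun a => by ring
      simp_rw [this, ← Finset.mul_sum, h0, mul_zero]) k
    (by
      have : ∀ a, p a * (τ⁻¹ * z a) ^ 2 = (τ⁻¹) ^ 2 * (p a * z a ^ 2) := fun a => by ring
      simp_rw [this, ← Finset.mul_sum, hv]
      rw [inv_pow, hτ2]
      push_cast at hnv ⊢
      field_simp) (δ := B / τ) (by positivity)
    (fun a => by
      rw [abs_mul, abs_of_pos (inv_pos.2 hτ0), inv_mul_eq_div]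
      have := hB a
      gcongr) (t / τ)
  have e : iidF p (fun a => τ⁻¹ * z a) (k + 1) (t / τ) = iidF p z (k + 1) t := by
    unfold iidF
    rw [iidE_smul]
    congr 1; funext s
    simp only [inv_mul_eq_div, div_le_div_iff_of_pos_right hτ0]
  rw [e] at key
  rw [mul_div_assoc]
  exact key

end BerryEsseen

section Abel

variable {α : Type*} [Fintype α]

lemma integrableOn_mul_exp_neg {c : ℝ} (hc : 0 < c) (r : ℝ) :
    IntegrableOn (fun v => c * Real.exp (-c * v)) (Set.Ioi r) :=
  (integrableOn_exp_mul_Ioi (by linarith) r).const_mul c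

lemma integral_mul_exp_neg {c : ℝ} (hc : 0 < c) (r : ℝ) :
    ∫ v in Set.Ioi r, c * Real.exp (-c * v) = Real.exp (-c * r) := by
  rw [integral_const_mul, integral_exp_mul_Ioi (by linarith)]
  field_simp

lemma mul_exp_window_eq {c t s v : ℝ} (hts : t < s) :
    c * Real.exp (-c * v) * (if t < s ∧ s ≤ t + v then 1 else 0)
      = (Set.Ici (s - t)).indicator (fun v => c * Real.exp (-c * v)) v := by
  by_cases h : s ≤ t + v
  · rw [if_pos ⟨hts, h⟩, Set.indicator_of_mem (by simp only [Set.mem_Ici]; linarith), mul_one]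
  · rw [if_neg (fun h' => h h'.2),
      Set.indicator_of_notMem (by simp only [Set.mem_Ici]; linarith), mul_zero]

lemma integrableOn_mul_exp_window {c : ℝ} (hc : 0 < c) (t s : ℝ) :
    IntegrableOn (fun v => c * Real.exp (-c * v) * (if t < s ∧ s ≤ t + v then 1 else 0))
      (Set.Ioi 0) := by
  by_cases hts : t < s
  · simp_rw [mul_exp_window_eq hts]
    exact (integrableOn_mul_exp_neg hc 0).indicator measurableSet_Ici
  · simp [hts]

lemma integral_mul_exp_window {c : ℝ} (hc : 0 < c) (t s : ℝ) :
    ∫ v in Set.Ioi 0, c * Real.exp (-c * v) * (if t < s ∧ s ≤ t + v then 1 else 0)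
      = if t < s then Real.exp (-c * (s - t)) else 0 := by
  by_cases hts : t < s
  · simp_rw [mul_exp_window_eq hts, if_pos hts]
    rw [setIntegral_indicator measurableSet_Ici]
    have : Set.Ioi (0 : ℝ) ∩ Set.Ici (s - t) = Set.Ici (s - t) :=
      Set.inter_eq_right.2 fun v (hv : s - t ≤ v) => lt_of_lt_of_le (by linarith) hv
    rw [this, integral_Ici_eq_integral_Ioi, integral_mul_exp_neg hc]
  · simp [hts]

/-- Summation by parts for exponentially weighted upper tails. -/
lemma iidE_exp_tail (p z : α → ℝ) (n : ℕ) {c : ℝ} (hc : 0 < c) (t : ℝ) :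
    IntegrableOn (fun v => c * Real.exp (-c * v) * (iidF p z n (t + v) - iidF p z n t))
        (Set.Ioi 0) ∧
      iidE p z n (fun s => if t < s then Real.exp (-c * (s - t)) else 0)
        = ∫ v in Set.Ioi 0, c * Real.exp (-c * v) * (iidF p z n (t + v) - iidF p z n t) := by
  have e : ∀ v ∈ Set.Ioi (0 : ℝ), iidE p z n
      (fun s => c * Real.exp (-c * v) * (if t < s ∧ s ≤ t + v then 1 else 0))
      = c * Real.exp (-c * v) * (iidF p z n (t + v) - iidF p z n t) := fun v hv => by
    rw [iidE_mul, iidE_window p z n (by linarith [Set.mem_Ioi.1 hv])]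
  constructor
  · refine IntegrableOn.congr_fun (integrable_iidE p z n fun s => ?_) e measurableSet_Ioi
    exact integrableOn_mul_exp_window hc t s
  · rw [← setIntegral_congr_fun measurableSet_Ioi e]
    rw [integral_iidE p z n
      (f := fun v s => c * Real.exp (-c * v) * (if t < s ∧ s ≤ t + v then 1 else 0))
      fun s => integrableOn_mul_exp_window hc t s]
    simp_rw [integral_mul_exp_window hc]

lemma abs_iidE_exp_tail_sub_le {p z : α → ℝ} {n : ℕ} {c t D : ℝ} (hc : 0 < c) {G : ℝ → ℝ}
    (hG : IntegrableOn (fun v => c * Real.exp (-c * v) * G v) (Set.Ioi 0))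
    (hD : ∀ v, 0 < v → |iidF p z n (t + v) - iidF p z n t - G v| ≤ D) :
    |iidE p z n (fun s => if t < s then Real.exp (-c * (s - t)) else 0)
      - ∫ v in Set.Ioi 0, c * Real.exp (-c * v) * G v| ≤ D := by
  obtain ⟨h1, h2⟩ := iidE_exp_tail p z n hc t
  rw [h2, ← integral_sub h1 hG]
  have := norm_integral_le_of_norm_le (μ := volume.restrict (Set.Ioi (0 : ℝ)))
    (f := fun v => c * Real.exp (-c * v) * (iidF p z n (t + v) - iidF p z n t)
      - c * Real.exp (-c * v) * G v) (g := fun v => c * Real.exp (-c * v) * D)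
    ((integrableOn_mul_exp_neg hc 0).mul_const D)
    ((ae_restrict_iff' measurableSet_Ioi).2 (Eventually.of_forall fun v hv => by
      rw [← mul_sub, Real.norm_eq_abs, abs_mul, abs_of_pos (by positivity)]
      exact mul_le_mul_of_nonneg_left (hD v hv) (by positivity)))
  rw [integral_mul_const, integral_mul_exp_neg hc] at this
  simpa using this

lemma tendsto_exp_neg_mul_atTop {c : ℝ} (hc : 0 < c) :
    Tendsto (fun v => Real.exp (-c * v)) atTop (nhds 0) := by
  simp_rw [neg_mul]
  exact Real.tendsto_exp_neg_atTop_nhds_zero.comp (tendsto_id.const_mul_atTop hc)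

lemma integral_mul_exp_mul_id {c : ℝ} (hc : 0 < c) :
    IntegrableOn (fun v => c * Real.exp (-c * v) * v) (Set.Ioi 0) ∧
      ∫ v in Set.Ioi 0, c * Real.exp (-c * v) * v = 1 / c := by
  have hd : ∀ v ∈ Set.Ici (0 : ℝ), HasDerivAt (fun v => -Real.exp (-c * v) * (v + 1 / c))
      (c * Real.exp (-c * v) * v) v := fun v _ => by
    have h1 : HasDerivAt (fun v => Real.exp (-c * v)) (Real.exp (-c * v) * (-c)) v := by
      simpa using ((hasDerivAt_id v).const_mul (-c)).exp
    refine (h1.neg.mul ((hasDerivAt_id v).add_const (1 / c))).congr_deriv ?_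
    simp only [Pi.neg_apply, id]
    field_simp
    ring
  have hlim : Tendsto (fun v => -Real.exp (-c * v) * (v + 1 / c)) atTop (nhds 0) := by
    have h1 : Tendsto (fun v : ℝ => (c * v) ^ 1 * Real.exp (-(c * v))) atTop (nhds 0) :=
      (Real.tendsto_pow_mul_exp_neg_atTop_nhds_zero 1).comp (tendsto_id.const_mul_atTop hc)
    have h2 := (h1.add (tendsto_exp_neg_mul_atTop hc)).const_mul (-(1 / c))
    simp only [add_zero, mul_zero] at h2
    refine h2.congr fun v => ?_
    rw [neg_mul]
    field_simp
  have hn : ∀ v ∈ Set.Ioi (0 : ℝ), 0 ≤ c * Real.exp (-c * v) * v := fun v hv => by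
    have : 0 < v := hv
    positivity
  refine ⟨integrableOn_Ioi_deriv_of_nonneg' hd hn hlim, ?_⟩
  rw [integral_Ioi_of_hasDerivAt_of_nonneg' hd hn hlim]
  simp

lemma integral_mul_exp_mul_gaussQ {c τ : ℝ} (hc : 0 < c) (hτ : 0 < τ) :
    IntegrableOn (fun v => c * Real.exp (-c * v) * (1 / 2 - gaussQ (v / τ))) (Set.Ioi 0) ∧
      ∫ v in Set.Ioi 0, c * Real.exp (-c * v) * (1 / 2 - gaussQ (v / τ)) = mills (c * τ) := by
  have hd : ∀ v ∈ Set.Ici (0 : ℝ), HasDerivAt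
      (fun v => -Real.exp (-c * v) * (1 / 2 - gaussQ (v / τ))
        - Real.exp ((c * τ) ^ 2 / 2) * gaussQ (c * τ + v / τ))
      (c * Real.exp (-c * v) * (1 / 2 - gaussQ (v / τ))) v := fun v _ => by
    have h1 : HasDerivAt (fun v => Real.exp (-c * v)) (Real.exp (-c * v) * (-c)) v := by
      simpa using ((hasDerivAt_id v).const_mul (-c)).exp
    have h2 : HasDerivAt (fun v => gaussQ (v / τ)) (-gaussPhi (v / τ) * (1 / τ)) v :=
      (hasDerivAt_gaussQ (v / τ)).comp (h := fun v : ℝ => v / τ) v ((hasDerivAt_id v).div_const τ)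
    have h3 : HasDerivAt (fun v => gaussQ (c * τ + v / τ))
        (-gaussPhi (c * τ + v / τ) * (1 / τ)) v :=
      (hasDerivAt_gaussQ _).comp (h := fun v : ℝ => c * τ + v / τ) v (((hasDerivAt_id v).div_const τ).const_add (c * τ))
    have h4 : Real.exp ((c * τ) ^ 2 / 2) * gaussPhi (c * τ + v / τ)
        = Real.exp (-c * v) * gaussPhi (v / τ) := by
      unfold gaussPhi
      rw [mul_left_comm, ← Real.exp_add, mul_left_comm, ← Real.exp_add]
      congr 2
      field_simp
      ring
    have key := (h1.neg.mul (h2.const_sub (1 / 2))).sub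
      (h3.const_mul (Real.exp ((c * τ) ^ 2 / 2)))
    refine key.congr_deriv ?_
    have h5 : Real.exp ((c * τ) ^ 2 / 2) * (-gaussPhi (c * τ + v / τ) * (1 / τ))
        = -(Real.exp (-c * v) * gaussPhi (v / τ)) * (1 / τ) := by rw [← h4]; ring
    rw [h5, Pi.neg_apply]
    ring
  have hn : ∀ v ∈ Set.Ioi (0 : ℝ), 0 ≤ c * Real.exp (-c * v) * (1 / 2 - gaussQ (v / τ)) :=
    fun v hv => by
      have h0 : 0 < v := hv
      have : gaussQ (v / τ) ≤ gaussQ 0 := strictAnti_gaussQ.antitone (by positivity)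
      rw [gaussQ_zero] at this
      have : 0 ≤ 1 / 2 - gaussQ (v / τ) := by linarith
      positivity
  have hlim : Tendsto (fun v => -Real.exp (-c * v) * (1 / 2 - gaussQ (v / τ))
        - Real.exp ((c * τ) ^ 2 / 2) * gaussQ (c * τ + v / τ)) atTop (nhds 0) := by
    have t1 : Tendsto (fun v : ℝ => v / τ) atTop atTop := tendsto_id.atTop_div_const hτ
    have h1 := (tendsto_exp_neg_mul_atTop hc).neg.mul
      ((tendsto_gaussQ_atTop.comp t1).const_sub (1 / 2))
    have h2 := (tendsto_gaussQ_atTop.comp (tendsto_atTop_add_const_left atTop (c * τ) t1)).const_mul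
      (Real.exp ((c * τ) ^ 2 / 2))
    simpa using h1.sub h2
  refine ⟨integrableOn_Ioi_deriv_of_nonneg' hd hn hlim, ?_⟩
  rw [integral_Ioi_of_hasDerivAt_of_nonneg' hd hn hlim]
  simp [gaussQ_zero, mills]

lemma abs_iidE_exp_tail_sub_mills_le {p z : α → ℝ} (h1 : ∑ a, p a = 1) {n : ℕ} {c τ D : ℝ}
    (hc : 0 ≤ c) (hτ : 0 < τ)
    (hD : ∀ t, |iidF p z n t - (1 - gaussQ (t / τ))| ≤ D) :
    |iidE p z n (fun s => if 0 < s then Real.exp (-c * s) else 0) - mills (c * τ)| ≤ 2 * D := by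
  have hD0 : 0 ≤ D := (abs_nonneg _).trans (hD 0)
  have d0 := hD 0
  rw [zero_div, gaussQ_zero] at d0
  rcases hc.eq_or_lt with rfl | hc
  · have := iidE_gt h1 z n 0
    simp only [neg_zero, zero_mul, Real.exp_zero, this, mills]
    norm_num [gaussQ_zero]
    rw [abs_le] at d0 ⊢
    constructor <;> linarith [d0.1, d0.2]
  · obtain ⟨hi, he⟩ := integral_mul_exp_mul_gaussQ hc hτ
    have := abs_iidE_exp_tail_sub_le (p := p) (z := z) (n := n) (t := 0) (D := 2 * D) hc hi
      fun v _ => by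
        have d1 := hD (0 + v)
        rw [zero_add] at d1 ⊢
        rw [abs_le] at d0 d1 ⊢
        constructor <;> linarith [d0.1, d0.2, d1.1, d1.2]
    rw [he] at this
    simpa using this

lemma iidE_exp_tail_le {p z : α → ℝ} {n : ℕ} {c τ D : ℝ} (hc : 0 < c) (hτ : 0 < τ)
    (hD : ∀ t, |iidF p z n t - (1 - gaussQ (t / τ))| ≤ D) (t : ℝ) :
    iidE p z n (fun s => if t < s then Real.exp (-c * (s - t)) else 0)
      ≤ 1 / (c * τ) + 2 * D := by
  obtain ⟨hi, he⟩ := integral_mul_exp_mul_id hc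
  obtain ⟨h1, h2⟩ := iidE_exp_tail p z n hc t
  rw [h2]
  have hi' := (hi.mul_const (1 / τ)).add ((integrableOn_mul_exp_neg hc 0).mul_const (2 * D))
  have := setIntegral_mono_on h1 hi' measurableSet_Ioi fun v hv => by
    have hv0 : (0 : ℝ) < v := hv
    have d0 := (abs_le.1 (hD t)).1
    have d1 := (abs_le.1 (hD (t + v))).2
    have d2 := gaussQ_sub_le (a := t / τ) (b := (t + v) / τ) (by gcongr; linarith)
    have e : (t + v) / τ - t / τ = v * (1 / τ) := by ring
    have : iidF p z n (t + v) - iidF p z n t ≤ v * (1 / τ) + 2 * D := by linarith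
    calc _ ≤ c * Real.exp (-c * v) * (v * (1 / τ) + 2 * D) :=
          mul_le_mul_of_nonneg_left this (by positivity)
      _ = (fun v => c * Real.exp (-c * v) * v * (1 / τ)) v
          + (fun v => c * Real.exp (-c * v) * (2 * D)) v := by ring
  refine this.trans_eq ?_
  simp only [Pi.add_apply]
  rw [integral_add (hi.mul_const (1 / τ)) ((integrableOn_mul_exp_neg hc 0).mul_const (2 * D)),
    integral_mul_const, integral_mul_const, he, integral_mul_exp_neg hc]
  simp
  field_simp

end Abel

section Tilting

lemma exists_continuousAt_remainder {g : ℝ → ℝ} {k : ℕ} {c C δ : ℝ} (hδ : 0 < δ) (h0 : g 0 = 0)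
    (hk : k ≠ 0) (h : ∀ x, |x| ≤ δ → |g x - c * x ^ k| ≤ C * |x| ^ (k + 1)) :
    ∃ R : ℝ → ℝ, ContinuousAt R 0 ∧ ∀ x, g x = x ^ k * R x := by
  refine ⟨fun x => if x = 0 then c else g x / x ^ k, ?_, fun x => ?_⟩
  · have hb : ∀ᶠ x in nhds (0 : ℝ), |(if x = 0 then c else g x / x ^ k) - c| ≤ C * |x| := by
      filter_upwards [Metric.closedBall_mem_nhds (0 : ℝ) hδ] with x hx
      rw [mem_closedBall_zero_iff, Real.norm_eq_abs] at hx
      by_cases hx0 : x = 0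
      · simp [hx0]
      · rw [if_neg hx0]
        have hp : 0 < |x| ^ k := by positivity
        have e : g x / x ^ k - c = (g x - c * x ^ k) / x ^ k := by field_simp
        rw [e, abs_div, abs_pow, div_le_iff₀ hp]
        calc _ ≤ _ := h x hx
          _ = _ := by ring
    have ht : Tendsto (fun x : ℝ => C * |x|) (nhds 0) (nhds 0) := by
      have : Continuous fun x : ℝ => C * |x| := by fun_prop
      simpa using this.tendsto 0
    have := tendsto_iff_norm_sub_tendsto_zero.2 (squeeze_zero' (Eventually.of_forall fun x =>
      norm_nonneg ((if x = 0 then c else g x / x ^ k) - c)) hb ht)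
    simpa [ContinuousAt] using this
  · by_cases hx0 : x = 0
    · simp [hx0, h0, hk]
    · simp only [if_neg hx0]
      field_simp

lemma exists_exp_remainder : ∃ R : ℝ → ℝ, ContinuousAt R 0 ∧
    ∀ x, Real.exp x = 1 + x + x ^ 2 / 2 + x ^ 3 / 6 + x ^ 4 / 24 + x ^ 5 * R x := by
  obtain ⟨R, hR, h⟩ := exists_continuousAt_remainder
    (g := fun x => Real.exp x - (1 + x + x ^ 2 / 2 + x ^ 3 / 6 + x ^ 4 / 24)) (k := 5)
    (c := 1 / 120) (C := 1) (δ := 1) one_pos (by simp) (by norm_num) fun x hx => by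
      have := Real.exp_bound hx (n := 6) (by norm_num)
      simp only [Finset.sum_range_succ, Finset.sum_range_zero, Nat.factorial] at this
      norm_num at this
      have h6 : 0 ≤ |x| ^ 6 := by positivity
      calc _ = |Real.exp x - (1 + x + x ^ 2 / 2 + x ^ 3 / 6 + x ^ 4 / 24 + x ^ 5 / 120)| := by
            congr 1; ring
        _ ≤ _ := this
        _ ≤ _ := by norm_num; linarith
  exact ⟨R, hR, fun x => by linarith [h x]⟩

lemma exists_log_remainder : ∃ R : ℝ → ℝ, ContinuousAt R 0 ∧
    ∀ x, Real.log (1 + x) = x - x ^ 2 / 2 + x ^ 3 * R x := by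
  obtain ⟨R, hR, h⟩ := exists_continuousAt_remainder
    (g := fun x => Real.log (1 + x) - (x - x ^ 2 / 2)) (k := 3)
    (c := 1 / 3) (C := 2) (δ := 1 / 2) (by norm_num) (by simp) (by norm_num) fun x hx => by
      have := Real.abs_log_sub_add_sum_range_le (x := -x) (by rw [abs_neg]; linarith) 3
      simp only [Finset.sum_range_succ, Finset.sum_range_zero, sub_neg_eq_add, abs_neg] at this
      norm_num at this
      calc _ = |-x + x ^ 2 / 2 + (-x) ^ 3 / 3 + Real.log (1 + x)| := by
            congr 1; ring
        _ ≤ _ := this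
        _ ≤ _ := by
          rw [div_le_iff₀ (by linarith)]
          have : 0 ≤ |x| ^ 4 := by positivity
          norm_num
          nlinarith
  exact ⟨R, hR, fun x => by linarith [h x]⟩

lemma ContinuousAt.eventually_abs_le {r : ℝ → ℝ} (h : ContinuousAt r 0) :
    ∃ C, 0 < C ∧ ∀ᶠ θ in nhds 0, |r θ| ≤ C :=
  ⟨|r 0| + 1, by positivity, h.abs.eventually_le_const (by simp)⟩

variable {α : Type*} [Fintype α]

/-- The `k`-th derivative of the moment generating function. -/
def tiltM (p z : α → ℝ) (k : ℕ) (θ : ℝ) : ℝ := ∑ a, p a * z a ^ k * Real.exp (θ * z a)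

/-- Mean of the exponentially tilted law. -/
def tiltMean (p z : α → ℝ) (θ : ℝ) : ℝ := tiltM p z 1 θ / tiltM p z 0 θ

/-- Variance of the exponentially tilted law. -/
def tiltVar (p z : α → ℝ) (θ : ℝ) : ℝ := tiltM p z 2 θ / tiltM p z 0 θ - tiltMean p z θ ^ 2

/-- Relative entropy of the exponentially tilted law. -/
def tiltRate (p z : α → ℝ) (θ : ℝ) : ℝ := θ * tiltMean p z θ - Real.log (tiltM p z 0 θ)

lemma continuous_tiltM (p z : α → ℝ) (k : ℕ) : Continuous (tiltM p z k) := by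
  unfold tiltM; fun_prop

lemma one_le_tiltM {p z : α → ℝ} (hp : ∀ a, 0 ≤ p a) (h1 : ∑ a, p a = 1)
    (h0 : ∑ a, p a * z a = 0) (θ : ℝ) : 1 ≤ tiltM p z 0 θ := by
  have : ∑ a, p a * (θ * z a + 1) ≤ ∑ a, p a * Real.exp (θ * z a) :=
    Finset.sum_le_sum fun a _ => mul_le_mul_of_nonneg_left (Real.add_one_le_exp _) (hp a)
  have e : ∑ a, p a * (θ * z a + 1) = θ * ∑ a, p a * z a + ∑ a, p a := by
    rw [Finset.mul_sum, ← Finset.sum_add_distrib]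
    exact Finset.sum_congr rfl fun a _ => by ring
  rw [e, h0, h1] at this
  simpa [tiltM] using this

lemma continuous_tiltRate {p z : α → ℝ} (hp : ∀ a, 0 ≤ p a) (h1 : ∑ a, p a = 1)
    (h0 : ∑ a, p a * z a = 0) : Continuous (tiltRate p z) := by
  have hM : ∀ θ, tiltM p z 0 θ ≠ 0 := fun θ => by linarith [one_le_tiltM hp h1 h0 θ]
  have := continuous_tiltM p z 0
  have := continuous_tiltM p z 1
  unfold tiltRate tiltMean
  fun_prop (disch := simp [hM])

lemma exists_tilt_remainders {p z : α → ℝ} (h1 : ∑ a, p a = 1) (h0 : ∑ a, p a * z a = 0) :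
    ∃ r₀ r₁ r₂ : ℝ → ℝ, ContinuousAt r₀ 0 ∧ ContinuousAt r₁ 0 ∧ ContinuousAt r₂ 0 ∧ ∀ θ,
      tiltM p z 0 θ = 1 + (∑ a, p a * z a ^ 2) * θ ^ 2 / 2 + (∑ a, p a * z a ^ 3) * θ ^ 3 / 6
        + (∑ a, p a * z a ^ 4) * θ ^ 4 / 24 + θ ^ 5 * r₀ θ ∧
      tiltM p z 1 θ = (∑ a, p a * z a ^ 2) * θ + (∑ a, p a * z a ^ 3) * θ ^ 2 / 2
        + (∑ a, p a * z a ^ 4) * θ ^ 3 / 6 + θ ^ 4 * r₁ θ ∧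
      tiltM p z 2 θ = (∑ a, p a * z a ^ 2) + θ * r₂ θ := by
  obtain ⟨R, hR, hexp⟩ := exists_exp_remainder
  obtain ⟨T, hT⟩ : ∃ T : α → ℝ → ℝ, ∀ a, T a = fun θ => R (θ * z a) := ⟨_, fun _ => rfl⟩
  have hc : ∀ a, ContinuousAt (T a) 0 := fun a => by
    rw [hT]
    exact ContinuousAt.comp (f := fun θ : ℝ => θ * z a) (g := R) (by simpa using hR) (by fun_prop)
  refine ⟨fun θ => ∑ a, p a * z a ^ 5 * T a θ,
    fun θ => ∑ a, p a * z a ^ 5 * (1 / 24 + θ * z a * T a θ),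
    fun θ => ∑ a, p a * z a ^ 3 * (1 + θ * z a / 2 + (θ * z a) ^ 2 / 6 + (θ * z a) ^ 3 / 24
      + (θ * z a) ^ 4 * T a θ), ?_, ?_, ?_, fun θ => ⟨?_, ?_, ?_⟩⟩
  · exact tendsto_finsetSum _ fun a _ => (show ContinuousAt _ 0 by have := hc a; fun_prop)
  · exact tendsto_finsetSum _ fun a _ => (show ContinuousAt _ 0 by have := hc a; fun_prop)
  · exact tendsto_finsetSum _ fun a _ => (show ContinuousAt _ 0 by
      have := hc a
      fun_prop (disch := norm_num))
  · unfold tiltM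
    have : θ * ∑ a, p a * z a = 0 := by rw [h0, mul_zero]
    rw [← h1, ← add_zero (∑ a, p a), ← this]
    simp only [Finset.sum_mul, Finset.mul_sum, Finset.sum_div, ← Finset.sum_add_distrib]
    refine Finset.sum_congr rfl fun a _ => ?_
    rw [hexp (θ * z a), hT]
    ring
  · unfold tiltM
    rw [← zero_add ((∑ a, p a * z a ^ 2) * θ), ← h0]
    simp only [Finset.sum_mul, Finset.mul_sum, Finset.sum_div, ← Finset.sum_add_distrib]
    refine Finset.sum_congr rfl fun a _ => ?_
    rw [hexp (θ * z a), hT]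
    ring
  · unfold tiltM
    simp only [Finset.mul_sum, ← Finset.sum_add_distrib]
    refine Finset.sum_congr rfl fun a _ => ?_
    rw [hexp (θ * z a), hT]
    ring

lemma exists_tilt_expansion {p z : α → ℝ} (hp : ∀ a, 0 ≤ p a) (h1 : ∑ a, p a = 1)
    (h0 : ∑ a, p a * z a = 0) {V A k : ℝ} (hV : ∑ a, p a * z a ^ 2 = V)
    (hA : ∑ a, p a * z a ^ 3 = A) (hk : ∑ a, p a * z a ^ 4 - 3 * V ^ 2 = k) :
    ∃ r s u : ℝ → ℝ, ContinuousAt r 0 ∧ ContinuousAt s 0 ∧ ContinuousAt u 0 ∧ ∀ θ,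
      tiltMean p z θ = V * θ + A * θ ^ 2 / 2 + k * θ ^ 3 / 6 + θ ^ 4 * r θ ∧
      2 * tiltRate p z θ
        = θ ^ 2 * (V + 2 * A * θ / 3 + k * θ ^ 2 / 4 + θ ^ 3 * s θ) ∧
      tiltVar p z θ = V + θ * u θ := by
  obtain ⟨r₀, r₁, r₂, c0, c1, c2, h⟩ := exists_tilt_remainders h1 h0
  obtain ⟨L, hL, hlog⟩ := exists_log_remainder
  have hM : ∀ θ, 0 < tiltM p z 0 θ := fun θ => by linarith [one_le_tiltM hp h1 h0 θ]
  have hM0 : ∀ θ, tiltM p z 0 θ ≠ 0 := fun θ => (hM θ).ne'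
  have cM : ContinuousAt (tiltM p z 0) 0 := (continuous_tiltM p z 0).continuousAt
  set m₄ := ∑ a, p a * z a ^ 4
  rw [hV, hA] at h
  set G : ℝ → ℝ := fun θ => A / 6 + m₄ * θ / 24 + θ ^ 2 * r₀ θ with hG
  set H : ℝ → ℝ := fun θ => V / 2 + θ * G θ with hH
  have cG : ContinuousAt G 0 := by fun_prop (disch := norm_num)
  have cH : ContinuousAt H 0 := by fun_prop (disch := norm_num)
  have eM : ∀ θ, tiltM p z 0 θ = 1 + θ ^ 2 * H θ := fun θ => by rw [(h θ).1, hH, hG]; ring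
  set r : ℝ → ℝ := fun θ => (r₁ θ - V * G θ - (A / 2 + k * θ / 6) * H θ) / tiltM p z 0 θ with hr
  have cr : ContinuousAt r 0 := by fun_prop (disch := simp [hM0])
  have er : ∀ θ, tiltMean p z θ = V * θ + A * θ ^ 2 / 2 + k * θ ^ 3 / 6 + θ ^ 4 * r θ := fun θ => by
    unfold tiltMean
    rw [div_eq_iff (hM0 θ)]
    have : θ ^ 4 * r θ * tiltM p z 0 θ
        = θ ^ 4 * (r₁ θ - V * G θ - (A / 2 + k * θ / 6) * H θ) := by
      rw [hr]; field_simp [hM0 θ]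
    rw [add_mul, this, (h θ).2.1, eM, ← hk]
    simp only [hH]
    ring
  obtain ⟨T, hT⟩ : ∃ T : ℝ → ℝ, T = fun θ => L (θ ^ 2 * H θ) := ⟨_, rfl⟩
  have cT : ContinuousAt T 0 := by
    rw [hT]
    exact ContinuousAt.comp (f := fun θ => θ ^ 2 * H θ) (g := L) (by simpa using hL) (by fun_prop)
  refine ⟨r, fun θ => 2 * (r θ - r₀ θ + (H θ + V / 2) * G θ / 2 - θ * H θ ^ 3 * T θ),
    fun θ => (r₂ θ - V * θ * H θ) / tiltM p z 0 θ
      - θ * (V + A * θ / 2 + k * θ ^ 2 / 6 + θ ^ 3 * r θ) ^ 2, cr, ?_, ?_, fun θ => ⟨er θ, ?_, ?_⟩⟩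
  · fun_prop (disch := norm_num)
  · fun_prop (disch := simp [hM0])
  · unfold tiltRate
    rw [er, eM, hlog, ← hk, hT]
    simp only [hH, hG]
    ring
  · unfold tiltVar
    rw [er, (h θ).2.2]
    have : (V + θ * r₂ θ) / tiltM p z 0 θ = V + θ * ((r₂ θ - V * θ * H θ) / tiltM p z 0 θ) := by
      field_simp [hM0 θ]
      rw [eM]
      ring
    rw [this]
    ring

end Tilting

section TiltBounds

variable {α : Type*} [Fintype α]

lemma exists_sqrt_remainder {c₂ c₃ : ℝ} {s : ℝ → ℝ} (hs : ContinuousAt s 0) :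
    ∃ q : ℝ → ℝ, ContinuousAt q 0 ∧ ∀ᶠ θ in nhds 0,
      Real.sqrt (1 + 2 * c₂ * θ + (2 * c₃ + c₂ ^ 2) * θ ^ 2 + θ ^ 3 * s θ)
        = 1 + c₂ * θ + c₃ * θ ^ 2 + θ ^ 3 * q θ := by
  set F : ℝ → ℝ := fun θ => 1 + 2 * c₂ * θ + (2 * c₃ + c₂ ^ 2) * θ ^ 2 + θ ^ 3 * s θ with hF
  have cF : ContinuousAt F 0 := by fun_prop
  set D : ℝ → ℝ := fun θ => Real.sqrt (F θ) + (1 + c₂ * θ + c₃ * θ ^ 2) with hD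
  have cD : ContinuousAt D 0 := by fun_prop
  have F0 : F 0 = 1 := by simp [hF]
  have D0 : D 0 = 2 := by simp [hD, F0]; norm_num
  have hD0 : D 0 ≠ 0 := by rw [D0]; norm_num
  refine ⟨fun θ => (s θ - 2 * c₂ * c₃ - c₃ ^ 2 * θ) / D θ, by fun_prop (disch := assumption), ?_⟩
  filter_upwards [cF.eventually_const_lt (by rw [F0]; exact one_pos),
    cD.eventually_ne hD0] with θ h1 h2
  have e : Real.sqrt (F θ) - (1 + c₂ * θ + c₃ * θ ^ 2)
      = θ ^ 3 * ((s θ - 2 * c₂ * c₃ - c₃ ^ 2 * θ) / D θ) := by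
    rw [← mul_div_assoc, eq_div_iff h2]
    have := Real.sq_sqrt h1.le
    calc _ = Real.sqrt (F θ) ^ 2 - (1 + c₂ * θ + c₃ * θ ^ 2) ^ 2 := by simp only [hD]; ring
      _ = F θ - (1 + c₂ * θ + c₃ * θ ^ 2) ^ 2 := by rw [this]
      _ = _ := by simp only [hF]; ring
  linarith

set_option maxHeartbeats 400000 in
lemma exists_tilt_bounds {p z : α → ℝ} (hp : ∀ a, 0 ≤ p a) (h1 : ∑ a, p a = 1)
    (h0 : ∑ a, p a * z a = 0) {V A k : ℝ} (hV : ∑ a, p a * z a ^ 2 = V)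
    (hA : ∑ a, p a * z a ^ 3 = A) (hk : ∑ a, p a * z a ^ 4 - 3 * V ^ 2 = k) (hV0 : 0 < V) :
    ∃ C, 0 < C ∧ ∀ᶠ θ in nhds 0,
      V / 2 ≤ tiltVar p z θ ∧ tiltVar p z θ ≤ 2 * V ∧
      |θ ^ 2 * tiltVar p z θ - 2 * tiltRate p z θ| ≤ C * |θ| ^ 3 ∧
      V * θ ^ 2 / 2 ≤ 2 * tiltRate p z θ ∧ 2 * tiltRate p z θ ≤ 2 * V * θ ^ 2 ∧
      ∀ w, w ^ 2 = 2 * tiltRate p z θ → θ * w ≤ 0 →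
        |tiltMean p z θ + Real.sqrt V * w - A / (6 * V) * w ^ 2
          - -(3 * k * V - 4 * A ^ 2) / (72 * V ^ 2 * Real.sqrt V) * w ^ 3| ≤ C * w ^ 4 := by
  obtain ⟨r, s, u, cr, cs, cu, h⟩ := exists_tilt_expansion hp h1 h0 hV hA hk
  obtain ⟨c₂, hc2⟩ : ∃ c, c = A / (3 * V) := ⟨_, rfl⟩
  obtain ⟨c₃, hc3⟩ : ∃ c, c = k / (8 * V) - A ^ 2 / (18 * V ^ 2) := ⟨_, rfl⟩
  obtain ⟨q, cq, hq⟩ := exists_sqrt_remainder (c₂ := c₂) (c₃ := c₃) (s := fun θ => s θ / V)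
    (by fun_prop (disch := exact hV0.ne'))
  set S := Real.sqrt V with hS
  have hS0 : 0 < S := Real.sqrt_pos.2 hV0
  have hS2 : S ^ 2 = V := Real.sq_sqrt hV0.le
  have eA : A = 3 * V * c₂ := by rw [hc2]; field_simp
  have ek : k = 8 * V * c₃ + 4 * V * c₂ ^ 2 := by rw [hc2, hc3]; field_simp; ring
  have ea : A / (6 * V) = c₂ / 2 := by rw [hc2]; field_simp; ring
  have eb : -(3 * k * V - 4 * A ^ 2) / (72 * V ^ 2 * S) = -(c₃ - c₂ ^ 2) / (3 * S) := by
    rw [eA, ek]; field_simp; ring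
  set G : ℝ → ℝ := fun θ => V + 2 * A * θ / 3 + k * θ ^ 2 / 4 + θ ^ 3 * s θ with hG
  have cG : ContinuousAt G 0 := by fun_prop (disch := norm_num)
  have G0 : G 0 = V := by simp [hG]
  set Y : ℝ → ℝ := fun θ => c₂ + c₃ * θ + θ ^ 2 * q θ with hY
  have cY : ContinuousAt Y 0 := by fun_prop
  set E : ℝ → ℝ := fun θ => r θ - V * q θ - c₂ * V / 2 * (2 * c₃ + 2 * θ * q θ + Y θ ^ 2)
    - (c₃ - c₂ ^ 2) * V / 3 * (3 * Y θ + 3 * θ * Y θ ^ 2 + θ ^ 2 * Y θ ^ 3) with hE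
  have cE : ContinuousAt E 0 := by fun_prop
  obtain ⟨C₁, hC1, bE⟩ := ContinuousAt.eventually_abs_le cE
  have cdiff : ContinuousAt (fun θ => u θ - (2 * A / 3 + k * θ / 4 + θ ^ 2 * s θ)) 0 := by
    fun_prop (disch := norm_num)
  obtain ⟨C₂, hC2, bd⟩ := ContinuousAt.eventually_abs_le cdiff
  have cv : ContinuousAt (fun θ => V + θ * u θ) 0 := by fun_prop
  refine ⟨C₁ * (2 / V) ^ 2 + C₂, by positivity, ?_⟩
  filter_upwards [hq, bE, bd, cG.eventually_const_lt (u := V / 2) (by rw [G0]; linarith),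
    cG.eventually_lt_const (u := 2 * V) (by rw [G0]; linarith),
    cv.eventually_const_lt (u := V / 2) (by simp; linarith),
    cv.eventually_lt_const (u := 2 * V) (by simp; linarith)] with θ hq bE bd g1 g2 v1 v2
  obtain ⟨eκ, eJ, ev⟩ := h θ
  have eJ' : 2 * tiltRate p z θ = θ ^ 2 * G θ := eJ
  have hθ2 : 0 ≤ θ ^ 2 := sq_nonneg θ
  have j1 : θ ^ 2 * (V / 2) ≤ θ ^ 2 * G θ := mul_le_mul_of_nonneg_left g1.le hθ2
  have j2 : θ ^ 2 * G θ ≤ θ ^ 2 * (2 * V) := mul_le_mul_of_nonneg_left g2.le hθ2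
  rw [ev, eJ']
  refine ⟨v1.le, v2.le, ?_, by linarith, by linarith, fun w hw hθw => ?_⟩
  · have : θ ^ 2 * (V + θ * u θ) - θ ^ 2 * G θ
        = θ ^ 3 * (u θ - (2 * A / 3 + k * θ / 4 + θ ^ 2 * s θ)) := by
      simp only [hG]; ring
    rw [this, abs_mul, abs_pow, mul_comm]
    have : 0 ≤ C₁ * (2 / V) ^ 2 := by positivity
    gcongr
    linarith
  · have hsq : Real.sqrt (G θ) = S * (1 + θ * Y θ) := by
      have e1 : G θ = V * (1 + 2 * c₂ * θ + (2 * c₃ + c₂ ^ 2) * θ ^ 2 + θ ^ 3 * (s θ / V)) := by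
        simp only [hG]
        rw [eA, ek]
        field_simp
        ring
      rw [e1, Real.sqrt_mul hV0.le, hq]
      simp only [hY]
      ring
    have hg0 : 0 < Real.sqrt (G θ) := Real.sqrt_pos.2 (by linarith)
    have hw' : w = -(θ * Real.sqrt (G θ)) := by
      have : w ^ 2 = (θ * Real.sqrt (G θ)) ^ 2 := by
        rw [hw, mul_pow, Real.sq_sqrt (by linarith)]
      rcases sq_eq_sq_iff_eq_or_eq_neg.1 this with h' | h'
      · rw [h'] at hθw
        have : θ = 0 := by
          by_contra hne
          have : 0 < θ ^ 2 * Real.sqrt (G θ) := by positivity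
          nlinarith
        rw [h', this]; simp
      · exact h'
    have key : tiltMean p z θ + S * w - A / (6 * V) * w ^ 2
          - -(3 * k * V - 4 * A ^ 2) / (72 * V ^ 2 * S) * w ^ 3 = θ ^ 4 * E θ := by
      have e3 : -(c₃ - c₂ ^ 2) / (3 * S) * (-(θ * (S * (1 + θ * Y θ)))) ^ 3
          = (c₃ - c₂ ^ 2) / 3 * V * (θ * (1 + θ * Y θ)) ^ 3 := by
        rw [← hS2]; field_simp
      have e2 : S * (-(θ * (S * (1 + θ * Y θ)))) = -V * θ * (1 + θ * Y θ) := by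
        rw [← hS2]; ring
      have e4 : (-(θ * (S * (1 + θ * Y θ)))) ^ 2 = V * (θ * (1 + θ * Y θ)) ^ 2 := by
        rw [← hS2]; ring
      rw [ea, eb, hw', hsq, e3, e2, e4, eκ, eA, ek]
      simp only [hE, hY]
      ring
    rw [key, abs_mul, abs_of_nonneg (by positivity : 0 ≤ θ ^ 4)]
    have hw4 : θ ^ 4 ≤ (2 / V) ^ 2 * w ^ 4 := by
      have h1 : θ ^ 2 ≤ 2 / V * w ^ 2 := by
        rw [hw, div_mul_eq_mul_div, le_div_iff₀ hV0]
        linarith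
      calc θ ^ 4 = (θ ^ 2) ^ 2 := by ring
        _ ≤ (2 / V * w ^ 2) ^ 2 := by gcongr
        _ = _ := by ring
    have : 0 ≤ w ^ 4 := by positivity
    calc θ ^ 4 * |E θ| ≤ ((2 / V) ^ 2 * w ^ 4) * C₁ := by gcongr
      _ = C₁ * (2 / V) ^ 2 * w ^ 4 := by ring
      _ ≤ _ := by
        rw [add_mul]
        exact le_add_of_nonneg_right (mul_nonneg hC2.le this)

end TiltBounds

section TiltedLaw

variable {α : Type*} [Fintype α]

/-- Weights of the exponentially tilted law. -/
def tiltP (p z : α → ℝ) (θ : ℝ) (a : α) : ℝ := p a * Real.exp (θ * z a) / tiltM p z 0 θ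

/-- Summand centered with respect to the exponentially tilted law. -/
def tiltZ (p z : α → ℝ) (θ : ℝ) (a : α) : ℝ := z a - tiltMean p z θ

lemma sum_tiltP_mul_pow (p z : α → ℝ) (θ : ℝ) (k : ℕ) :
    ∑ a, tiltP p z θ a * z a ^ k = tiltM p z k θ / tiltM p z 0 θ := by
  unfold tiltP
  rw [show tiltM p z k θ = ∑ a, p a * z a ^ k * Real.exp (θ * z a) from rfl, Finset.sum_div]
  exact Finset.sum_congr rfl fun a _ => by ring

lemma iidE_eq_tilt {p z : α → ℝ} {θ : ℝ} (hM : 0 < tiltM p z 0 θ) (n : ℕ) (f : ℝ → ℝ) :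
    iidE p z n f = Real.exp (-(n * tiltRate p z θ)) * iidE (tiltP p z θ) (tiltZ p z θ) n
      (fun t => Real.exp (-θ * t) * f (t + n * tiltMean p z θ)) := by
  have e1 : iidE (tiltP p z θ) (tiltZ p z θ) n
      (fun t => Real.exp (-θ * t) * f (t + n * tiltMean p z θ))
      = (tiltM p z 0 θ ^ n)⁻¹ * iidE p z n
        (fun s => Real.exp (θ * (n * tiltMean p z θ)) * f s) := by
    unfold tiltP tiltZ
    rw [iidE_shift, iidE_tilt hM.ne']
    congr 2; funext s
    rw [← mul_assoc, ← Real.exp_add, sub_add_cancel]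
    congr 2; ring
  have e2 : Real.exp (-(n * tiltRate p z θ))
      = tiltM p z 0 θ ^ n * Real.exp (-(θ * (n * tiltMean p z θ))) := by
    have : tiltM p z 0 θ ^ n = Real.exp (n * Real.log (tiltM p z 0 θ)) := by
      rw [Real.exp_nat_mul, Real.exp_log hM]
    rw [this, ← Real.exp_add]
    congr 1; unfold tiltRate; ring
  rw [e1, iidE_mul, e2, Real.exp_neg]
  have := Real.exp_pos (θ * (n * tiltMean p z θ))
  field_simp

/-- Uniform control of an exponentially tilted centered law. -/
structure TiltControl (p z : α → ℝ) (V B C θ : ℝ) : Prop where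
  nonneg : ∀ a, 0 ≤ p a
  sum_one : ∑ a, p a = 1
  bound : ∀ a, |z a| ≤ B
  one_le : 1 ≤ tiltM p z 0 θ
  var_pos : 0 < V
  bound_pos : 0 < B
  const_pos : 0 < C
  abs_le : |θ| ≤ 1 / 4
  var_ge : V / 2 ≤ tiltVar p z θ
  var_le : tiltVar p z θ ≤ 2 * V
  rate_close : |θ ^ 2 * tiltVar p z θ - 2 * tiltRate p z θ| ≤ C * |θ| ^ 3
  rate_ge : V * θ ^ 2 / 2 ≤ 2 * tiltRate p z θ

/-- The constant of the uniform Berry–Esseen bound for tilted laws. -/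
def tiltBE (V B : ℝ) : ℝ := berryEsseenConst * (2 * B) / Real.sqrt (V / 2)

variable {p z : α → ℝ} {V B C θ : ℝ}

namespace TiltControl

lemma pos (h : TiltControl p z V B C θ) : 0 < tiltM p z 0 θ := by linarith [h.one_le]

lemma tiltP_nonneg (h : TiltControl p z V B C θ) (a : α) : 0 ≤ tiltP p z θ a :=
  div_nonneg (mul_nonneg (h.nonneg a) (Real.exp_pos _).le) h.pos.le

lemma sum_tiltP (h : TiltControl p z V B C θ) : ∑ a, tiltP p z θ a = 1 := by
  have := sum_tiltP_mul_pow p z θ 0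
  simpa [div_self h.pos.ne'] using this

lemma sum_tiltP_mul (h : TiltControl p z V B C θ) : ∑ a, tiltP p z θ a * tiltZ p z θ a = 0 := by
  have := sum_tiltP_mul_pow p z θ 1
  simp only [pow_one] at this
  unfold tiltZ
  simp_rw [mul_sub, Finset.sum_sub_distrib, ← Finset.sum_mul, this, h.sum_tiltP, one_mul]
  exact sub_self _

lemma sum_tiltP_mul_sq (h : TiltControl p z V B C θ) :
    ∑ a, tiltP p z θ a * tiltZ p z θ a ^ 2 = tiltVar p z θ := by
  have h1 := sum_tiltP_mul_pow p z θ 1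
  have h2 := sum_tiltP_mul_pow p z θ 2
  simp only [pow_one] at h1
  have e : ∀ a, tiltP p z θ a * tiltZ p z θ a ^ 2 = tiltP p z θ a * z a ^ 2
      - 2 * tiltMean p z θ * (tiltP p z θ a * z a) + tiltMean p z θ ^ 2 * tiltP p z θ a :=
    fun a => by unfold tiltZ; ring
  simp_rw [e, Finset.sum_add_distrib, Finset.sum_sub_distrib, ← Finset.mul_sum, h1, h2,
    h.sum_tiltP]
  unfold tiltVar tiltMean
  ring

lemma abs_tiltZ_le (h : TiltControl p z V B C θ) (a : α) : |tiltZ p z θ a| ≤ 2 * B := by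
  have hm : |tiltMean p z θ| ≤ B := by
    have := sum_tiltP_mul_pow p z θ 1
    simp only [pow_one] at this
    unfold tiltMean
    rw [← this]
    calc |∑ a, tiltP p z θ a * z a| ≤ ∑ a, |tiltP p z θ a * z a| := Finset.abs_sum_le_sum_abs _ _
      _ ≤ ∑ a, tiltP p z θ a * B := Finset.sum_le_sum fun a _ => by
          rw [abs_mul, abs_of_nonneg (h.tiltP_nonneg a)]
          exact mul_le_mul_of_nonneg_left (h.bound a) (h.tiltP_nonneg a)
      _ = B := by rw [← Finset.sum_mul, h.sum_tiltP, one_mul]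
  unfold tiltZ
  have := abs_sub (z a) (tiltMean p z θ)
  linarith [h.bound a]

lemma tiltVar_pos (h : TiltControl p z V B C θ) : 0 < tiltVar p z θ := by
  linarith [h.var_ge, h.var_pos]

lemma tiltBE_pos (h : TiltControl p z V B C θ) : 0 < tiltBE V B := by
  have := h.var_pos
  have := h.bound_pos
  have := one_le_berryEsseenConst
  unfold tiltBE
  positivity

lemma sqrt_le (h : TiltControl p z V B C θ) (n : ℕ) :
    Real.sqrt n * Real.sqrt (V / 2) ≤ Real.sqrt (n * tiltVar p z θ) := by
  rw [← Real.sqrt_mul (Nat.cast_nonneg n)]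
  exact Real.sqrt_le_sqrt (mul_le_mul_of_nonneg_left h.var_ge (Nat.cast_nonneg n))

lemma le_sqrt (h : TiltControl p z V B C θ) (n : ℕ) :
    Real.sqrt (n * tiltVar p z θ) ≤ Real.sqrt n * Real.sqrt (2 * V) := by
  rw [← Real.sqrt_mul (Nat.cast_nonneg n)]
  exact Real.sqrt_le_sqrt (mul_le_mul_of_nonneg_left h.var_le (Nat.cast_nonneg n))

lemma berry_esseen (h : TiltControl p z V B C θ) {n : ℕ} (hn : 0 < n) (t : ℝ) :
    |iidF (tiltP p z θ) (tiltZ p z θ) n t - (1 - gaussQ (t / Real.sqrt (n * tiltVar p z θ)))|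
      ≤ tiltBE V B / Real.sqrt n := by
  have hB := h.bound_pos
  have hV := h.var_pos
  refine (_root_.berry_esseen h.tiltP_nonneg h.sum_tiltP h.sum_tiltP_mul h.sum_tiltP_mul_sq
    h.tiltVar_pos (by linarith : 0 < 2 * B) h.abs_tiltZ_le hn t).trans ?_
  have hn' : (0 : ℝ) < n := Nat.cast_pos.2 hn
  have := one_le_berryEsseenConst
  unfold tiltBE
  rw [div_div, mul_comm (Real.sqrt (V / 2))]
  have := h.sqrt_le n
  gcongr

lemma sqrt_pos (h : TiltControl p z V B C θ) {n : ℕ} (hn : 0 < n) :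
    0 < Real.sqrt (n * tiltVar p z θ) :=
  Real.sqrt_pos.2 (mul_pos (Nat.cast_pos.2 hn) h.tiltVar_pos)

lemma abs_mills_sub_le (h : TiltControl p z V B C θ) {n : ℕ} (hn : 0 < n) (hθ : 0 ≤ θ) :
    |mills (θ * Real.sqrt (n * tiltVar p z θ)) - mills (Real.sqrt (2 * (n * tiltRate p z θ)))|
      ≤ C / (2 * Real.sqrt (V / 2) ^ 3) / Real.sqrt n := by
  have hV := h.var_pos
  have hn' : (0 : ℝ) < n := Nat.cast_pos.2 hn
  have hC := h.const_pos
  rcases hθ.eq_or_lt with h0 | hθ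
  · subst h0
    have hr := h.rate_close
    simp only [ne_eq, OfNat.ofNat_ne_zero, not_false_eq_true, zero_pow, zero_mul, zero_sub, abs_neg,
      abs_zero, mul_zero] at hr
    have : tiltRate p z 0 = 0 := by
      have := abs_eq_zero.1 (le_antisymm hr (abs_nonneg _))
      linarith
    rw [this]
    simp only [mul_zero, Real.sqrt_zero, zero_mul, sub_self, abs_zero]
    positivity
  · set u := θ * Real.sqrt (n * tiltVar p z θ) with hu
    set y := Real.sqrt (2 * (n * tiltRate p z θ)) with hy
    set m := θ * (Real.sqrt n * Real.sqrt (V / 2)) with hm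
    have hm0 : 0 < m := by positivity
    have hmu : m ≤ u := mul_le_mul_of_nonneg_left (h.sqrt_le n) hθ.le
    have hJ : 0 ≤ tiltRate p z θ := by nlinarith [h.rate_ge, sq_nonneg θ]
    have hm2 : m ^ 2 = n * (V * θ ^ 2 / 2) := by
      rw [hm, mul_pow, mul_pow, Real.sq_sqrt hn'.le, Real.sq_sqrt (by positivity)]; ring
    have hmy : m ≤ y := by
      refine Real.le_sqrt_of_sq_le ?_
      rw [hm2]
      nlinarith [mul_le_mul_of_nonneg_left h.rate_ge hn'.le]
    have hy2 : y ^ 2 = 2 * (n * tiltRate p z θ) := Real.sq_sqrt (by positivity)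
    have hu2 : u ^ 2 = n * (θ ^ 2 * tiltVar p z θ) := by
      rw [hu, mul_pow, Real.sq_sqrt (mul_nonneg hn'.le h.tiltVar_pos.le)]; ring
    have hd : |u - y| * (2 * m) ≤ n * (C * θ ^ 3) := by
      calc |u - y| * (2 * m) ≤ |u - y| * (u + y) := by
            have := abs_nonneg (u - y)
            gcongr; linarith
        _ = |u ^ 2 - y ^ 2| := by
            rw [← abs_of_pos (by linarith : 0 < u + y), ← abs_mul]
            congr 1; ring
        _ = n * |θ ^ 2 * tiltVar p z θ - 2 * tiltRate p z θ| := by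
            rw [hy2, hu2, ← abs_of_pos hn', ← abs_mul]
            congr 1; rw [abs_of_pos hn']; ring
        _ ≤ _ := by
            have := h.rate_close
            rw [abs_of_pos hθ] at this
            gcongr
    refine (_root_.abs_mills_sub_le hm0 hmu hmy).trans ?_
    rw [div_div, div_le_div_iff₀ (by positivity) (by positivity)]
    have hs : Real.sqrt n ^ 2 = n := Real.sq_sqrt hn'.le
    have e1 : C * m ^ 2 * (2 * m)
        = n * (C * θ ^ 3) * (2 * Real.sqrt (V / 2) ^ 3 * Real.sqrt n) := by
      calc _ = Real.sqrt n ^ 2 * (C * θ ^ 3) * (2 * Real.sqrt (V / 2) ^ 3 * Real.sqrt n) := by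
            rw [hm]; ring
        _ = _ := by rw [hs]
    have e2 : |u - y| * (2 * Real.sqrt (V / 2) ^ 3 * Real.sqrt n) * (2 * m)
        ≤ C * m ^ 2 * (2 * m) := by
      rw [e1]
      calc _ = |u - y| * (2 * m) * (2 * Real.sqrt (V / 2) ^ 3 * Real.sqrt n) := by ring
        _ ≤ _ := by gcongr
    exact le_of_mul_le_mul_right e2 (by positivity)

/-- Upper tail at the tilted mean, nonnegative tilt. -/
lemma abs_tail_sub_le (h : TiltControl p z V B C θ) {n : ℕ} (hn : 0 < n) (hθ : 0 ≤ θ) :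
    |1 - iidF p z n (n * tiltMean p z θ) - gaussQ (Real.sqrt (2 * (n * tiltRate p z θ)))|
      ≤ (2 * tiltBE V B + C / (2 * Real.sqrt (V / 2) ^ 3))
        * (Real.exp (-(n * tiltRate p z θ)) / Real.sqrt n) := by
  have hV := h.var_pos
  have hn' : (0 : ℝ) < n := Nat.cast_pos.2 hn
  have hJ : 0 ≤ tiltRate p z θ := by nlinarith [h.rate_ge, sq_nonneg θ]
  have e1 : 1 - iidF p z n (n * tiltMean p z θ) = Real.exp (-(n * tiltRate p z θ))
      * iidE (tiltP p z θ) (tiltZ p z θ) n (fun s => if 0 < s then Real.exp (-θ * s) else 0) := by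
    rw [← iidE_gt h.sum_one z n, iidE_eq_tilt h.pos]
    simp
  have e2 : gaussQ (Real.sqrt (2 * (n * tiltRate p z θ))) = Real.exp (-(n * tiltRate p z θ))
      * mills (Real.sqrt (2 * (n * tiltRate p z θ))) := by
    rw [gaussQ_eq_mills, Real.sq_sqrt (by positivity)]
    congr 2; ring
  rw [e1, e2, ← mul_sub, abs_mul, abs_of_pos (Real.exp_pos _)]
  have b1 := abs_iidE_exp_tail_sub_mills_le h.sum_tiltP hθ (h.sqrt_pos hn) (h.berry_esseen hn)
  have b2 := h.abs_mills_sub_le hn hθ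
  calc _ ≤ Real.exp (-(n * tiltRate p z θ))
        * (2 * (tiltBE V B / Real.sqrt n) + C / (2 * Real.sqrt (V / 2) ^ 3) / Real.sqrt n) := by
        gcongr
        exact (abs_sub_le _ _ _).trans (add_le_add b1 b2)
    _ = _ := by ring

end TiltControl

end TiltedLaw

section TiltEstimates

variable {α : Type*} [Fintype α] {p z : α → ℝ} {V B C θ : ℝ}

lemma tiltM_reflect (p z : α → ℝ) (k : ℕ) (θ : ℝ) :
    tiltM p (fun a => -1 * z a) k (-θ) = (-1) ^ k * tiltM p z k θ := by
  unfold tiltM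
  rw [Finset.mul_sum]
  refine Finset.sum_congr rfl fun a _ => ?_
  rw [mul_pow, show -θ * (-1 * z a) = θ * z a by ring]
  ring

lemma tiltMean_reflect (p z : α → ℝ) (θ : ℝ) :
    tiltMean p (fun a => -1 * z a) (-θ) = -tiltMean p z θ := by
  simp only [tiltMean, tiltM_reflect]
  ring

lemma tiltVar_reflect (p z : α → ℝ) (θ : ℝ) :
    tiltVar p (fun a => -1 * z a) (-θ) = tiltVar p z θ := by
  simp only [tiltVar, tiltMean_reflect, tiltM_reflect]
  ring

lemma tiltRate_reflect (p z : α → ℝ) (θ : ℝ) :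
    tiltRate p (fun a => -1 * z a) (-θ) = tiltRate p z θ := by
  simp only [tiltRate, tiltMean_reflect, tiltM_reflect]
  simp

/-- The constant of the exponential tail bound for tilted laws. -/
def tiltTail (V B : ℝ) : ℝ := Real.exp 2 * (2 / Real.sqrt (V / 2) + 2 * tiltBE V B)

namespace TiltControl

lemma reflect (h : TiltControl p z V B C θ) :
    TiltControl p (fun a => -1 * z a) V B C (-θ) where
  nonneg := h.nonneg
  sum_one := h.sum_one
  bound a := by simpa using h.bound a
  one_le := by simpa only [tiltM_reflect, pow_zero, one_mul] using h.one_le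
  var_pos := h.var_pos
  bound_pos := h.bound_pos
  const_pos := h.const_pos
  abs_le := by simpa using h.abs_le
  var_ge := by simpa only [tiltVar_reflect] using h.var_ge
  var_le := by simpa only [tiltVar_reflect] using h.var_le
  rate_close := by
    rw [tiltVar_reflect, tiltRate_reflect, neg_sq, abs_neg]
    exact h.rate_close
  rate_ge := by
    rw [tiltRate_reflect, neg_sq]
    exact h.rate_ge

lemma tiltTail_pos (h : TiltControl p z V B C θ) : 0 < tiltTail V B := by
  have := h.var_pos
  have := h.tiltBE_pos
  unfold tiltTail
  positivity

lemma exp_tail_le (h : TiltControl p z V B C θ) {n : ℕ} (hn : 0 < n) {c : ℝ} (hc : 1 / 2 ≤ c)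
    (hc2 : c ≤ 2) (t : ℝ) :
    iidE (tiltP p z θ) (tiltZ p z θ) n (fun s => if t ≤ s then Real.exp (-c * s) else 0)
      ≤ tiltTail V B * (Real.exp (-c * t) / Real.sqrt n) := by
  have hc0 : 0 < c := by linarith
  have hn' : 0 < Real.sqrt n := Real.sqrt_pos.2 (Nat.cast_pos.2 hn)
  have hV : 0 < Real.sqrt (V / 2) := Real.sqrt_pos.2 (by linarith [h.var_pos])
  have hBE := h.tiltBE_pos
  have h1 : iidE (tiltP p z θ) (tiltZ p z θ) n (fun s => if t ≤ s then Real.exp (-c * s) else 0)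
      ≤ iidE (tiltP p z θ) (tiltZ p z θ) n (fun s => Real.exp (-c * (t - 1)) *
        (if t - 1 < s then Real.exp (-c * (s - (t - 1))) else 0)) := by
    refine iidE_mono h.tiltP_nonneg _ n fun s => ?_
    by_cases hs : t ≤ s
    · rw [if_pos hs, if_pos (by linarith), ← Real.exp_add]
      exact le_of_eq (congrArg _ (by ring))
    · rw [if_neg hs]
      split_ifs <;> positivity
  rw [iidE_mul] at h1
  have h2 := iidE_exp_tail_le (p := tiltP p z θ) (z := tiltZ p z θ) hc0 (h.sqrt_pos hn)
    (h.berry_esseen hn) (t - 1)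
  have h3 : 1 / (c * Real.sqrt (n * tiltVar p z θ)) ≤ 2 / Real.sqrt (V / 2) / Real.sqrt n := by
    rw [div_div, div_le_div_iff₀ (mul_pos hc0 (h.sqrt_pos hn)) (by positivity)]
    have := h.sqrt_le n
    have h4 := mul_le_mul hc this (by positivity) hc0.le
    linarith
  refine h1.trans ((mul_le_mul_of_nonneg_left h2 (Real.exp_pos _).le).trans ?_)
  calc _ ≤ Real.exp (2 + -c * t) *
        (2 / Real.sqrt (V / 2) / Real.sqrt n + 2 * (tiltBE V B / Real.sqrt n)) := by
        gcongr; linarith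
    _ = _ := by rw [Real.exp_add]; unfold tiltTail; ring

lemma atom_le (h : TiltControl p z V B C θ) {n : ℕ} (hn : 0 < n) :
    iidE p z n (fun s => if s = n * tiltMean p z θ then 1 else 0)
      ≤ tiltTail V B * (Real.exp (-(n * tiltRate p z θ)) / Real.sqrt n) := by
  rw [iidE_eq_tilt h.pos]
  have h1 := h.exp_tail_le hn (c := 1) (by norm_num) (by norm_num) 0
  have h2 : iidE (tiltP p z θ) (tiltZ p z θ) n (fun t => Real.exp (-θ * t) *
      if t + n * tiltMean p z θ = n * tiltMean p z θ then 1 else 0)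
      ≤ iidE (tiltP p z θ) (tiltZ p z θ) n
        (fun s => if 0 ≤ s then Real.exp (-1 * s) else 0) := by
    refine iidE_mono h.tiltP_nonneg _ n fun s => ?_
    by_cases hs : s = 0
    · simp [hs]
    · simp only [add_eq_right, hs, if_false, mul_zero]
      split_ifs <;> positivity
  calc _ ≤ Real.exp (-(n * tiltRate p z θ))
        * (tiltTail V B * (Real.exp (-1 * 0) / Real.sqrt n)) := by
        gcongr
        exact h2.trans h1
    _ = _ := by simp; ring

/-- The constant of the cumulative distribution function estimate. -/
def cdfConst (V B C : ℝ) : ℝ :=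
  2 * tiltBE V B + C / (2 * Real.sqrt (V / 2) ^ 3) + tiltTail V B

lemma cdfConst_pos (h : TiltControl p z V B C θ) : 0 < cdfConst V B C := by
  have := h.var_pos
  have := h.tiltBE_pos
  have := h.tiltTail_pos
  have := h.const_pos
  unfold cdfConst
  positivity

/-- Moderate-deviation estimate of the distribution function at the tilted mean. -/
lemma abs_cdf_sub_le (h : TiltControl p z V B C θ) {n : ℕ} (hn : 0 < n) {x : ℝ}
    (hx : x ^ 2 = 2 * (n * tiltRate p z θ)) (hθx : θ * x ≤ 0) :
    |iidF p z n (n * tiltMean p z θ) - gaussQ x|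
      ≤ cdfConst V B C * (Real.exp (-(n * tiltRate p z θ)) / Real.sqrt n) := by
  set e := Real.exp (-(n * tiltRate p z θ)) / Real.sqrt n with he
  have he0 : 0 ≤ e := by positivity
  have hT := mul_nonneg h.tiltTail_pos.le he0
  have hy : Real.sqrt (2 * (n * tiltRate p z θ)) = |x| := by rw [← hx, Real.sqrt_sq_eq_abs]
  have pos_case : 0 ≤ θ → x ≤ 0 → |iidF p z n (n * tiltMean p z θ) - gaussQ x|
      ≤ cdfConst V B C * e := fun hθ hx0 => by
    have := h.abs_tail_sub_le hn hθ
    rw [hy, abs_of_nonpos hx0, gaussQ_neg, ← he] at this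
    rw [_root_.abs_le] at this ⊢
    unfold cdfConst
    constructor <;> linarith [this.1, this.2]
  have neg_case : θ ≤ 0 → 0 ≤ x → |iidF p z n (n * tiltMean p z θ) - gaussQ x|
      ≤ cdfConst V B C * e := fun hθ hx0 => by
    have h1 := h.reflect.abs_tail_sub_le hn (by linarith)
    rw [tiltRate_reflect, tiltMean_reflect, hy, abs_of_nonneg hx0, ← he,
      ← iidE_gt h.sum_one, iidE_smul] at h1
    have h2 : iidF p z n (n * tiltMean p z θ)
        = iidE p z n (fun s => if n * -tiltMean p z θ < -1 * s then 1 else 0)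
          + iidE p z n (fun s => if s = n * tiltMean p z θ then 1 else 0) := by
      unfold iidF
      rw [← iidE_add]
      congr 1; funext s
      rcases lt_trichotomy s (n * tiltMean p z θ) with hs | hs | hs
      · rw [if_pos hs.le, if_pos (by linarith), if_neg hs.ne, add_zero]
      · rw [if_pos hs.le, if_neg (by linarith), if_pos hs, zero_add]
      · rw [if_neg (by linarith), if_neg (by linarith), if_neg hs.ne', add_zero]
    have h3 := h.atom_le hn
    rw [← he] at h3
    have h4 := iidE_nonneg h.nonneg z n (f := fun s => if s = n * tiltMean p z θ then 1 else 0)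
      fun s => by split_ifs <;> norm_num
    rw [h2]
    rw [_root_.abs_le] at h1 ⊢
    unfold cdfConst
    constructor <;> linarith [h1.1, h1.2]
  rcases lt_trichotomy θ 0 with h0 | h0 | h0
  · exact neg_case h0.le (by nlinarith)
  · rcases le_total x 0 with hx0 | hx0
    · exact pos_case h0.ge hx0
    · exact neg_case h0.le hx0
  · exact pos_case h0.le (by nlinarith)

/-- Lower bound for the mass of a window near the tilted mean. -/
lemma le_window (h : TiltControl p z V B C θ) {n : ℕ} (hn : 0 < n) {a L : ℝ} (hL : 0 ≤ L)
    (hn2 : |a| + L ≤ Real.sqrt n * Real.sqrt (V / 2)) (hθ : |θ| * (|a| + L) ≤ 1) :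
    Real.exp (-1) * (gaussPhi 1 * (L / Real.sqrt (2 * V)) - 2 * tiltBE V B)
        * (Real.exp (-(n * tiltRate p z θ)) / Real.sqrt n)
      ≤ iidF p z n (n * tiltMean p z θ + a + L) - iidF p z n (n * tiltMean p z θ + a) := by
  set τ := Real.sqrt (n * tiltVar p z θ) with hτ
  have hτ0 : 0 < τ := h.sqrt_pos hn
  have hn' : 0 < Real.sqrt n := Real.sqrt_pos.2 (Nat.cast_pos.2 hn)
  have hV : 0 < Real.sqrt (2 * V) := Real.sqrt_pos.2 (by linarith [h.var_pos])
  rw [← iidE_window p z n (by linarith : n * tiltMean p z θ + a ≤ n * tiltMean p z θ + a + L),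
    iidE_eq_tilt h.pos]
  have h1 : iidE (tiltP p z θ) (tiltZ p z θ) n
      (fun t => Real.exp (-1) * (if a < t ∧ t ≤ a + L then 1 else 0))
      ≤ iidE (tiltP p z θ) (tiltZ p z θ) n (fun t => Real.exp (-θ * t) *
        if n * tiltMean p z θ + a < t + n * tiltMean p z θ ∧
          t + n * tiltMean p z θ ≤ n * tiltMean p z θ + a + L then 1 else 0) := by
    refine iidE_mono h.tiltP_nonneg _ n fun t => ?_
    by_cases ht : a < t ∧ t ≤ a + L
    · rw [if_pos ht, if_pos ⟨by linarith [ht.1], by linarith [ht.2]⟩, mul_one, mul_one]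
      refine Real.exp_le_exp.2 ?_
      have ht2 : |t| ≤ |a| + L := _root_.abs_le.2
        ⟨by linarith [neg_abs_le a, ht.1], by linarith [le_abs_self a, ht.2]⟩
      have : |θ * t| ≤ 1 := by
        rw [abs_mul]
        exact (mul_le_mul_of_nonneg_left ht2 (abs_nonneg _)).trans hθ
      linarith [(_root_.abs_le.1 this).2]
    · rw [if_neg ht, mul_zero]
      split_ifs <;> positivity
  rw [iidE_mul, iidE_window _ _ n (by linarith)] at h1
  have b1 := (_root_.abs_le.1 (h.berry_esseen hn (a + L))).1
  have b2 := (_root_.abs_le.1 (h.berry_esseen hn a)).2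
  rw [← hτ] at b1 b2
  have hal : |a| + L ≤ τ := hn2.trans (h.sqrt_le n)
  have b3 := le_gaussQ_sub (a := a / τ) (b := (a + L) / τ) (by gcongr; linarith)
    (by rw [le_div_iff₀ hτ0]; linarith [neg_abs_le a])
    (by rw [div_le_one hτ0]; linarith [le_abs_self a])
  have b4 : L / Real.sqrt (2 * V) / Real.sqrt n ≤ (a + L) / τ - a / τ := by
    have : (a + L) / τ - a / τ = L / τ := by ring
    rw [this, div_div, mul_comm]
    have := h.le_sqrt n
    gcongr
  have b5 := mul_le_mul_of_nonneg_left b4 (gaussPhi_pos 1).le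
  have b6 : gaussPhi 1 * (L / Real.sqrt (2 * V) / Real.sqrt n) - 2 * (tiltBE V B / Real.sqrt n)
      ≤ iidF (tiltP p z θ) (tiltZ p z θ) n (a + L) - iidF (tiltP p z θ) (tiltZ p z θ) n a := by
    linarith
  calc _ = Real.exp (-(n * tiltRate p z θ)) * (Real.exp (-1) *
        (gaussPhi 1 * (L / Real.sqrt (2 * V) / Real.sqrt n) - 2 * (tiltBE V B / Real.sqrt n))) := by
        ring
    _ ≤ Real.exp (-(n * tiltRate p z θ)) * (Real.exp (-1) *
        (iidF (tiltP p z θ) (tiltZ p z θ) n (a + L) - iidF (tiltP p z θ) (tiltZ p z θ) n a)) := by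
        gcongr
    _ ≤ _ := by gcongr

/-- The confusion functional of random coding. -/
lemma confusion_le (h : TiltControl p z V B C θ) {n : ℕ} (hn : 0 < n) {L : ℝ} (hL : 0 ≤ L) :
    iidE p z n (fun s => if n * tiltMean p z θ - L ≤ s then
        iidE p z n (fun t => if s ≤ t then Real.exp (-t) else 0) else 0)
      ≤ tiltTail V B ^ 2 * Real.exp (2 * L)
        * (Real.exp (-(2 * (n * tiltRate p z θ)) - n * tiltMean p z θ) / n) := by
  have hθ := _root_.abs_le.1 h.abs_le
  set J := (n : ℝ) * tiltRate p z θ with hJ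
  set κ := (n : ℝ) * tiltMean p z θ with hκ
  have hn' : 0 < Real.sqrt n := Real.sqrt_pos.2 (Nat.cast_pos.2 hn)
  have hT := h.tiltTail_pos
  have inner : ∀ s, iidE p z n (fun t => if s ≤ t then Real.exp (-t) else 0)
      ≤ tiltTail V B * Real.exp (-J - κ) / Real.sqrt n * Real.exp (-(1 + θ) * (s - κ)) := by
    intro s
    rw [iidE_eq_tilt h.pos, ← hJ, ← hκ]
    have e : (fun t => Real.exp (-θ * t) * if s ≤ t + κ then Real.exp (-(t + κ)) else 0)
        = fun t => Real.exp (-κ) * (if s - κ ≤ t then Real.exp (-(1 + θ) * t) else 0) := by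
      funext t
      by_cases ht : s ≤ t + κ
      · rw [if_pos ht, if_pos (by linarith), ← Real.exp_add, ← Real.exp_add]
        congr 1; ring
      · rw [if_neg ht, if_neg (by linarith), mul_zero, mul_zero]
    rw [e, iidE_mul]
    have := h.exp_tail_le hn (c := 1 + θ) (by linarith) (by linarith) (s - κ)
    calc _ ≤ Real.exp (-J) * (Real.exp (-κ) *
          (tiltTail V B * (Real.exp (-(1 + θ) * (s - κ)) / Real.sqrt n))) := by gcongr
      _ = _ := by rw [sub_eq_add_neg (-J), Real.exp_add]; ring
  have outer : iidE p z n (fun s => if κ - L ≤ s then Real.exp (-(1 + θ) * (s - κ)) else 0)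
      ≤ Real.exp (-J) * (tiltTail V B * (Real.exp (2 * L) / Real.sqrt n)) := by
    rw [iidE_eq_tilt h.pos, ← hJ, ← hκ]
    have e : (fun t => Real.exp (-θ * t) * if κ - L ≤ t + κ then
          Real.exp (-(1 + θ) * (t + κ - κ)) else 0)
        = fun t => (if -L ≤ t then Real.exp (-(1 + 2 * θ) * t) else 0) := by
      funext t
      by_cases ht : -L ≤ t
      · rw [if_pos ht, if_pos (by linarith), ← Real.exp_add]
        congr 1; ring
      · rw [if_neg ht, if_neg (by linarith), mul_zero]
    rw [e]
    have := h.exp_tail_le hn (c := 1 + 2 * θ) (by linarith) (by linarith) (-L)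
    have hc : -(1 + 2 * θ) * -L ≤ 2 * L := by nlinarith
    exact mul_le_mul_of_nonneg_left (this.trans (mul_le_mul_of_nonneg_left
      (div_le_div_of_nonneg_right (Real.exp_le_exp.2 hc) hn'.le) hT.le)) (Real.exp_pos _).le
  calc _ ≤ iidE p z n (fun s => tiltTail V B * Real.exp (-J - κ) / Real.sqrt n *
        (if κ - L ≤ s then Real.exp (-(1 + θ) * (s - κ)) else 0)) := by
        refine iidE_mono h.nonneg z n fun s => ?_
        by_cases hs : κ - L ≤ s
        · rw [if_pos hs, if_pos hs]; exact inner s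
        · rw [if_neg hs, if_neg hs, mul_zero]
    _ ≤ tiltTail V B * Real.exp (-J - κ) / Real.sqrt n *
        (Real.exp (-J) * (tiltTail V B * (Real.exp (2 * L) / Real.sqrt n))) := by
        rw [iidE_mul]
        gcongr
    _ = tiltTail V B ^ 2 * Real.exp (2 * L) * (Real.exp (-J - κ) * Real.exp (-J)
        / (Real.sqrt n * Real.sqrt n)) := by ring
    _ = _ := by
        rw [← Real.exp_add, Real.mul_self_sqrt (Nat.cast_nonneg n)]
        congr 3; ring

end TiltControl

end TiltEstimates

section SymmetricChannel

set_option linter.unusedSectionVars false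

/-- Information density of the uniform input distribution, centered by the capacity. -/
def centDen (W : 𝓧 → 𝓨 → ℝ) (x : 𝓧) (y : 𝓨) : ℝ := iDen W (unifDist 𝓧) x y - capacity W

variable {W : 𝓧 → 𝓨 → ℝ} {n M : ℕ}

lemma CoverThomasSymmetric.sum_row_eq (hCT : CoverThomasSymmetric W) (φ : ℝ → ℝ) (x x' : 𝓧) :
    ∑ y, φ (W x' y) = ∑ y, φ (W x y) := by
  obtain ⟨σ, hσ⟩ := hCT.1 x x'
  simp_rw [hσ]
  exact Equiv.sum_comp σ fun y => φ (W x y)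

lemma CoverThomasSymmetric.sum_col_eq (hCT : CoverThomasSymmetric W) (φ : ℝ → ℝ) (y y' : 𝓨) :
    ∑ x, φ (W x y') = ∑ x, φ (W x y) := by
  obtain ⟨σ, hσ⟩ := hCT.2 y y'
  simp_rw [hσ]
  exact Equiv.sum_comp σ fun x => φ (W x y)

variable [Nonempty 𝓧] [Nonempty 𝓨]

lemma outDist_unifDist (hW : IsKernel W) (hCT : CoverThomasSymmetric W) (y : 𝓨) :
    outDist W (unifDist 𝓧) y = (Fintype.card 𝓨 : ℝ)⁻¹ := by
  have h1 : ∑ y', ∑ x, W x y' = Fintype.card 𝓨 * ∑ x, W x y := by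
    have h (y' : 𝓨) : ∑ x, W x y' = ∑ x, W x y := hCT.sum_col_eq id y y'
    simp [h]
  rw [Finset.sum_comm] at h1
  simp only [hW.2, Finset.sum_const, Finset.card_univ, nsmul_eq_mul, mul_one] at h1
  have hX : (Fintype.card 𝓧 : ℝ) ≠ 0 := Nat.cast_ne_zero.2 Fintype.card_ne_zero
  have hY : (Fintype.card 𝓨 : ℝ) ≠ 0 := Nat.cast_ne_zero.2 Fintype.card_ne_zero
  unfold outDist unifDist
  rw [← Finset.mul_sum]
  field_simp
  linarith

lemma iDen_unifDist (hW : IsKernel W) (hCT : CoverThomasSymmetric W) (x : 𝓧) (y : 𝓨) :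
    iDen W (unifDist 𝓧) x y = Real.log (W x y * Fintype.card 𝓨) := by
  rw [iDen, outDist_unifDist hW hCT, div_inv_eq_mul]

lemma isDist_unifDist : IsDist (unifDist 𝓧) := by
  refine ⟨fun x => by unfold unifDist; positivity, ?_⟩
  simp [unifDist]

lemma mutInfo_term_le (hW : IsKernel W) {p : 𝓧 → ℝ} (hp : IsDist p) (x : 𝓧) (y : 𝓨) :
    p x * W x y * iDen W p x y ≤ p x * W x y * Real.log (W x y * Fintype.card 𝓨)
      + p x * W x y / (outDist W p y * Fintype.card 𝓨) - p x * W x y := by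
  have hY : (0 : ℝ) < Fintype.card 𝓨 := Nat.cast_pos.2 Fintype.card_pos
  have hn : ∀ x, 0 ≤ p x * W x y := fun x => mul_nonneg (hp.1 x) (hW.1 x y)
  rcases (hn x).eq_or_lt with h0 | h0
  · simp [← h0]
  have hq : 0 < outDist W p y :=
    h0.trans_le (Finset.single_le_sum (f := fun x => p x * W x y) (fun x _ => hn x)
      (Finset.mem_univ x))
  have hw : 0 < W x y := pos_of_mul_pos_right h0 (hp.1 x)
  have hlog : Real.log (outDist W p y * Fintype.card 𝓨)⁻¹
      ≤ (outDist W p y * Fintype.card 𝓨)⁻¹ - 1 := Real.log_le_sub_one_of_pos (by positivity)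
  have he : iDen W p x y = Real.log (W x y * Fintype.card 𝓨)
      + Real.log (outDist W p y * Fintype.card 𝓨)⁻¹ := by
    rw [iDen, ← Real.log_mul (by positivity) (by positivity)]
    congr 1; field_simp
  rw [he]
  have := mul_le_mul_of_nonneg_left hlog h0.le
  rw [div_eq_mul_inv]
  linarith

lemma mutInfo_le (hW : IsKernel W) (hCT : CoverThomasSymmetric W) (x₀ : 𝓧) {p : 𝓧 → ℝ}
    (hp : IsDist p) : mutInfo W p ≤ ∑ y, W x₀ y * Real.log (W x₀ y * Fintype.card 𝓨) := by
  have hY : (0 : ℝ) < Fintype.card 𝓨 := Nat.cast_pos.2 Fintype.card_pos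
  have h1 : mutInfo W p ≤ ∑ x, ∑ y, (p x * W x y * Real.log (W x y * Fintype.card 𝓨)
      + p x * W x y / (outDist W p y * Fintype.card 𝓨) - p x * W x y) :=
    Finset.sum_le_sum fun x _ => Finset.sum_le_sum fun y _ => mutInfo_term_le hW hp x y
  simp only [Finset.sum_add_distrib, Finset.sum_sub_distrib] at h1
  have h2 : ∑ x, ∑ y, p x * W x y = 1 := by
    simp_rw [← Finset.mul_sum, hW.2, mul_one, hp.2]
  have h3 : ∑ x, ∑ y, p x * W x y / (outDist W p y * Fintype.card 𝓨) ≤ 1 := by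
    rw [Finset.sum_comm]
    calc _ ≤ ∑ _y : 𝓨, (Fintype.card 𝓨 : ℝ)⁻¹ := by
          refine Finset.sum_le_sum fun y _ => ?_
          rw [← Finset.sum_div]
          change outDist W p y / _ ≤ _
          rw [← div_div, inv_eq_one_div]
          exact div_le_div_of_nonneg_right (div_self_le_one _) hY.le
      _ = 1 := by simp
  have h4 : ∑ x, ∑ y, p x * W x y * Real.log (W x y * Fintype.card 𝓨)
      = ∑ y, W x₀ y * Real.log (W x₀ y * Fintype.card 𝓨) := by
    simp_rw [mul_assoc, ← Finset.mul_sum,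
      hCT.sum_row_eq (fun w => w * Real.log (w * Fintype.card 𝓨)) x₀]
    rw [← Finset.sum_mul, hp.2, one_mul]
  linarith

lemma sum_unifDist_mul (a : ℝ) : ∑ _x : 𝓧, unifDist 𝓧 _x * a = a := by
  rw [← Finset.sum_mul, isDist_unifDist.2, one_mul]

lemma capacity_eq (hW : IsKernel W) (hCT : CoverThomasSymmetric W) (x₀ : 𝓧) :
    capacity W = ∑ y, W x₀ y * Real.log (W x₀ y * Fintype.card 𝓨) := by
  refine IsGreatest.csSup_eq ⟨⟨unifDist 𝓧, isDist_unifDist, ?_⟩, ?_⟩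
  · unfold mutInfo
    simp_rw [mul_assoc, ← Finset.mul_sum, iDen_unifDist hW hCT,
      hCT.sum_row_eq (fun w => w * Real.log (w * Fintype.card 𝓨)) x₀]
    exact sum_unifDist_mul _
  · rintro _ ⟨p, hp, rfl⟩
    exact mutInfo_le hW hCT x₀ hp

lemma centDen_eq (hW : IsKernel W) (hCT : CoverThomasSymmetric W) (x : 𝓧) (y : 𝓨) :
    centDen W x y = Real.log (W x y * Fintype.card 𝓨) - capacity W := by
  rw [centDen, iDen_unifDist hW hCT]

lemma sum_mul_centDen (hW : IsKernel W) (hCT : CoverThomasSymmetric W) (x₀ : 𝓧) :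
    ∑ y, W x₀ y * centDen W x₀ y = 0 := by
  simp_rw [centDen_eq hW hCT, mul_sub, Finset.sum_sub_distrib, ← Finset.sum_mul, hW.2,
    ← capacity_eq hW hCT x₀]
  ring

lemma ctMoment_eq (hW : IsKernel W) (hCT : CoverThomasSymmetric W) (x₀ : 𝓧) (k : ℕ) :
    ctMoment W k = ∑ y, W x₀ y * centDen W x₀ y ^ k := by
  unfold ctMoment
  simp_rw [mul_assoc, ← Finset.mul_sum]
  change ∑ x, unifDist 𝓧 x * ∑ y, W x y * centDen W x y ^ k = _
  simp_rw [centDen_eq hW hCT,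
    hCT.sum_row_eq (fun w => w * (Real.log (w * Fintype.card 𝓨) - capacity W) ^ k) x₀]
  exact sum_unifDist_mul _

lemma sum_lik_row (hW : IsKernel W) (hCT : CoverThomasSymmetric W) (x₀ : 𝓧) (x : Fin n → 𝓧)
    (Φ : ℝ → ℝ → ℝ) :
    ∑ y : Fin n → 𝓨, Φ (∏ i, W (x i) (y i)) (∑ i, centDen W (x i) (y i))
      = ∑ y : Fin n → 𝓨, Φ (∏ i, W x₀ (y i)) (∑ i, centDen W x₀ (y i)) := by
  choose σ hσ using fun i => hCT.1 x₀ (x i)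
  simp_rw [centDen_eq hW hCT, hσ]
  exact Equiv.sum_comp (Equiv.piCongrRight σ) fun y => Φ (∏ i, W x₀ (y i))
    (∑ i, (Real.log (W x₀ (y i) * Fintype.card 𝓨) - capacity W))

lemma sum_lik_col (hW : IsKernel W) (hCT : CoverThomasSymmetric W) (x₀ : 𝓧) (y : Fin n → 𝓨)
    (Φ : ℝ → ℝ → ℝ) :
    (Fintype.card 𝓨 : ℝ) ^ n
        * ∑ x : Fin n → 𝓧, Φ (∏ i, W (x i) (y i)) (∑ i, centDen W (x i) (y i))
      = (Fintype.card 𝓧 : ℝ) ^ n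
        * ∑ y : Fin n → 𝓨, Φ (∏ i, W x₀ (y i)) (∑ i, centDen W x₀ (y i)) := by
  have h1 : ∀ y' : Fin n → 𝓨,
      ∑ x : Fin n → 𝓧, Φ (∏ i, W (x i) (y' i)) (∑ i, centDen W (x i) (y' i))
      = ∑ x : Fin n → 𝓧, Φ (∏ i, W (x i) (y i)) (∑ i, centDen W (x i) (y i)) := by
    intro y'
    choose σ hσ using fun i => hCT.2 (y i) (y' i)
    simp_rw [centDen_eq hW hCT, hσ]
    exact Equiv.sum_comp (Equiv.piCongrRight σ) fun x => Φ (∏ i, W (x i) (y i))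
      (∑ i, (Real.log (W (x i) (y i) * Fintype.card 𝓨) - capacity W))
  have h2 : ∑ y' : Fin n → 𝓨, ∑ x : Fin n → 𝓧,
      Φ (∏ i, W (x i) (y' i)) (∑ i, centDen W (x i) (y' i))
      = (Fintype.card 𝓨 : ℝ) ^ n
        * ∑ x : Fin n → 𝓧, Φ (∏ i, W (x i) (y i)) (∑ i, centDen W (x i) (y i)) := by
    rw [Finset.sum_congr rfl fun y' _ => h1 y']
    simp
  rw [← h2, Finset.sum_comm, Finset.sum_congr rfl fun x _ => sum_lik_row hW hCT x₀ x Φ]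
  simp

/-- A positive likelihood is determined by the accumulated centered information density. -/
lemma lik_mul_card (hW : IsKernel W) (hCT : CoverThomasSymmetric W) {x : Fin n → 𝓧}
    {y : Fin n → 𝓨} (h : ∏ i, W (x i) (y i) ≠ 0) :
    (Fintype.card 𝓨 : ℝ) ^ n * ∏ i, W (x i) (y i)
      = Real.exp (n * capacity W + ∑ i, centDen W (x i) (y i)) := by
  have hY : (0 : ℝ) < Fintype.card 𝓨 := Nat.cast_pos.2 Fintype.card_pos
  simp_rw [centDen_eq hW hCT, Finset.sum_sub_distrib]
  simp only [Finset.sum_const, Finset.card_univ, Fintype.card_fin, nsmul_eq_mul,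
    add_sub_cancel]
  rw [Real.exp_sum]
  have : ∀ i, Real.exp (Real.log (W (x i) (y i) * Fintype.card 𝓨))
      = W (x i) (y i) * Fintype.card 𝓨 := fun i =>
    Real.exp_log (mul_pos ((hW.1 _ _).lt_of_ne' (Finset.prod_ne_zero_iff.1 h i (mem_univ i))) hY)
  simp only [this, Finset.prod_mul_distrib, Finset.prod_const, Finset.card_univ, Fintype.card_fin]
  ring

/-- Converse bound for the size of a code. -/
lemma ExistsCode.mul_sub_le (hW : IsKernel W) (hCT : CoverThomasSymmetric W) (x₀ : 𝓧) {e : ℝ}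
    (hc : ExistsCode W n M e) (t : ℝ) :
    M * (iidF (W x₀) (centDen W x₀) n t - e) ≤ Real.exp (n * capacity W + t) := by
  obtain ⟨f, g, hfg⟩ := hc
  have hY : (0 : ℝ) < (Fintype.card 𝓨 : ℝ) ^ n :=
    pow_pos (Nat.cast_pos.2 Fintype.card_pos) n
  have hM : (0 : ℝ) < M := Nat.cast_pos.2 (Fin.pos_iff_nonempty.2 ⟨g fun _ => Classical.arbitrary 𝓨⟩)
  have term : ∀ (m : Fin M) (y : Fin n → 𝓨), (if g y = m then ∏ i, W (f m i) (y i) else 0)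
      ≤ (∏ i, W (f m i) (y i)) * (if t < ∑ i, centDen W (f m i) (y i) then 1 else 0)
        + (if g y = m then Real.exp (n * capacity W + t) / (Fintype.card 𝓨 : ℝ) ^ n else 0) := by
    intro m y
    have h0 : 0 ≤ ∏ i, W (f m i) (y i) := Finset.prod_nonneg fun i _ => hW.1 _ _
    by_cases hg : g y = m
    · rw [if_pos hg, if_pos hg]
      by_cases ht : t < ∑ i, centDen W (f m i) (y i)
      · rw [if_pos ht, mul_one]
        exact le_add_of_nonneg_right (by positivity)
      · rw [if_neg ht, mul_zero, zero_add, le_div_iff₀' hY]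
        by_cases hz : ∏ i, W (f m i) (y i) = 0
        · rw [hz, mul_zero]; positivity
        · rw [lik_mul_card hW hCT hz]
          exact Real.exp_le_exp.2 (by linarith)
    · rw [if_neg hg, if_neg hg, add_zero]
      exact mul_nonneg h0 (by split_ifs <;> norm_num)
  have row : ∀ m, ∑ y : Fin n → 𝓨, (∏ i, W (f m i) (y i))
      * (if t < ∑ i, centDen W (f m i) (y i) then (1 : ℝ) else 0)
      = 1 - iidF (W x₀) (centDen W x₀) n t := fun m => by
    rw [← iidE_gt (hW.2 x₀), iidE]
    exact sum_lik_row hW hCT x₀ (f m) fun w s => w * (if t < s then 1 else 0)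
  have h1 : ∑ m : Fin M, ∑ y : Fin n → 𝓨, (if g y = m then ∏ i, W (f m i) (y i) else 0)
      ≤ M * (1 - iidF (W x₀) (centDen W x₀) n t) + Real.exp (n * capacity W + t) := by
    refine (Finset.sum_le_sum fun m _ => Finset.sum_le_sum fun y _ => term m y).trans ?_
    simp only [Finset.sum_add_distrib, row]
    refine add_le_add (le_of_eq ?_) ?_
    · simp only [Finset.sum_const, Finset.card_univ, Fintype.card_fin, nsmul_eq_mul]
    rw [Finset.sum_comm]
    simp only [Finset.sum_ite_eq, Finset.mem_univ, if_true]
    refine le_of_eq ?_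
    simp only [Finset.sum_const, Finset.card_univ, Fintype.card_fun, Fintype.card_fin, nsmul_eq_mul,
      Nat.cast_pow]
    field_simp
  have h2 := mul_le_mul_of_nonneg_left hfg hM.le
  rw [avgErr, mul_sub, mul_one, ← mul_assoc, mul_inv_cancel₀ hM.ne', one_mul] at h2
  linarith

end SymmetricChannel

section RandomCoding

/-- Averaging over one coordinate of a tuple does not change the sum over all tuples. -/
lemma card_mul_sum_eq_sum_update {ι A : Type*} [Fintype ι] [DecidableEq ι] [Fintype A] (H : (ι → A) → ℝ)
    (m : ι) :
    Fintype.card A * ∑ f, H f = ∑ f, ∑ b, H (Function.update f m b) := by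
  have e : ∑ q : (ι → A) × A, H (Function.update q.1 m q.2) = ∑ q : (ι → A) × A, H q.1 := by
    refine Finset.sum_bij' (fun q _ => (Function.update q.1 m q.2, q.1 m))
      (fun q _ => (Function.update q.1 m q.2, q.1 m)) ?_ ?_ ?_ ?_ ?_ <;> simp
  rw [Fintype.sum_prod_type, Fintype.sum_prod_type] at e
  rw [e, Finset.mul_sum]
  simp

variable {W : 𝓧 → 𝓨 → ℝ} {n M : ℕ}

/-- Probability that `y` drawn from codeword `a` has density at least `γ` and is at least as
likely under the codeword `b`. -/
def confusion (W : 𝓧 → 𝓨 → ℝ) (n : ℕ) (γ : ℝ) (a b : Fin n → 𝓧) : ℝ :=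
  ∑ y : Fin n → 𝓨, if γ ≤ ∑ i, centDen W (a i) (y i) ∧
    ∏ i, W (a i) (y i) ≤ ∏ i, W (b i) (y i) then ∏ i, W (a i) (y i) else 0

variable [Nonempty 𝓧] [Nonempty 𝓨]

lemma sum_lik_le (hW : IsKernel W) (hCT : CoverThomasSymmetric W) (x₀ : 𝓧) {a : Fin n → 𝓧}
    {y : Fin n → 𝓨} (h : ∏ i, W (a i) (y i) ≠ 0) :
    ∑ b : Fin n → 𝓧, (if ∏ i, W (a i) (y i) ≤ ∏ i, W (b i) (y i) then (1 : ℝ) else 0)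
      = (Fintype.card 𝓧 : ℝ) ^ n * (Real.exp (-(n * capacity W)) *
        iidE (W x₀) (centDen W x₀) n
          (fun t => if ∑ i, centDen W (a i) (y i) ≤ t then Real.exp (-t) else 0)) := by
  have hY : (0 : ℝ) < (Fintype.card 𝓨 : ℝ) ^ n :=
    pow_pos (Nat.cast_pos.2 Fintype.card_pos) n
  have h0 : 0 < ∏ i, W (a i) (y i) :=
    (Finset.prod_nonneg fun i _ => hW.1 _ _).lt_of_ne' h
  have h1 := sum_lik_col hW hCT x₀ y
    fun w _ => if ∏ i, W (a i) (y i) ≤ w then (1 : ℝ) else 0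
  rw [← mul_right_inj' hY.ne', h1, mul_left_comm]
  congr 1
  rw [iidE, Finset.mul_sum, Finset.mul_sum]
  refine Finset.sum_congr rfl fun y' _ => ?_
  by_cases hz : ∏ i, W x₀ (y' i) = 0
  · rw [hz, if_neg (not_le.2 h0)]; ring
  have e1 := lik_mul_card hW hCT h
  have e2 := lik_mul_card hW hCT (x := fun _ => x₀) hz
  have hiff : ∏ i, W (a i) (y i) ≤ ∏ i, W x₀ (y' i)
      ↔ ∑ i, centDen W (a i) (y i) ≤ ∑ i, centDen W x₀ (y' i) := by
    rw [← mul_le_mul_iff_right₀ hY, e1, e2, Real.exp_le_exp, add_le_add_iff_left]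
  by_cases hle : ∑ i, centDen W (a i) (y i) ≤ ∑ i, centDen W x₀ (y' i)
  · rw [if_pos (hiff.2 hle), if_pos hle]
    calc (1 : ℝ) = Real.exp (n * capacity W + ∑ i, centDen W x₀ (y' i)) *
          (Real.exp (-(n * capacity W)) * Real.exp (-∑ i, centDen W x₀ (y' i))) := by
          rw [← Real.exp_add, ← Real.exp_add, ← Real.exp_zero]
          congr 1; ring
      _ = _ := by rw [← e2]; ring
  · rw [if_neg (fun h => hle (hiff.1 h)), if_neg hle]; ring

lemma sum_confusion (hW : IsKernel W) (hCT : CoverThomasSymmetric W) (x₀ : 𝓧) (γ : ℝ)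
    (a : Fin n → 𝓧) :
    ∑ b, confusion W n γ a b = (Fintype.card 𝓧 : ℝ) ^ n * (Real.exp (-(n * capacity W)) *
      iidE (W x₀) (centDen W x₀) n (fun s => if γ ≤ s then
        iidE (W x₀) (centDen W x₀) n (fun t => if s ≤ t then Real.exp (-t) else 0) else 0)) := by
  unfold confusion
  rw [Finset.sum_comm, iidE, ← sum_lik_row hW hCT x₀ a (fun w s => w * if γ ≤ s then
    iidE (W x₀) (centDen W x₀) n (fun t => if s ≤ t then Real.exp (-t) else 0) else 0),
    Finset.mul_sum, Finset.mul_sum]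
  refine Finset.sum_congr rfl fun y _ => ?_
  by_cases hγ : γ ≤ ∑ i, centDen W (a i) (y i)
  · simp only [hγ, true_and, if_true]
    by_cases hz : ∏ i, W (a i) (y i) = 0
    · simp [hz]
    have e : ∑ b : Fin n → 𝓧, (if ∏ i, W (a i) (y i) ≤ ∏ i, W (b i) (y i) then
        ∏ i, W (a i) (y i) else 0) = (∏ i, W (a i) (y i)) *
        ∑ b : Fin n → 𝓧, (if ∏ i, W (a i) (y i) ≤ ∏ i, W (b i) (y i) then (1 : ℝ) else 0) := by
      rw [Finset.mul_sum]
      exact Finset.sum_congr rfl fun b _ => by split_ifs <;> simp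
    rw [e, sum_lik_le hW hCT x₀ hz]
    ring
  · simp [hγ]

lemma sum_tuple_confusion (hW : IsKernel W) (hCT : CoverThomasSymmetric W) (x₀ : 𝓧) (γ : ℝ)
    {m m' : Fin M} (hm : m' ≠ m) :
    ∑ f : Fin M → Fin n → 𝓧, confusion W n γ (f m) (f m')
      = Fintype.card (Fin M → Fin n → 𝓧) * (Real.exp (-(n * capacity W)) *
      iidE (W x₀) (centDen W x₀) n (fun s => if γ ≤ s then
        iidE (W x₀) (centDen W x₀) n (fun t => if s ≤ t then Real.exp (-t) else 0) else 0)) := by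
  have h := card_mul_sum_eq_sum_update
    (fun f : Fin M → Fin n → 𝓧 => confusion W n γ (f m) (f m')) m'
  simp only [Function.update_self, Function.update_of_ne hm.symm, sum_confusion hW hCT x₀] at h
  have hX : (0 : ℝ) < (Fintype.card 𝓧 : ℝ) ^ n :=
    pow_pos (Nat.cast_pos.2 Fintype.card_pos) n
  rw [Finset.sum_const, nsmul_eq_mul, Finset.card_univ, Fintype.card_fun, Fintype.card_fin,
    Nat.cast_pow, mul_left_comm] at h
  exact mul_left_cancel₀ hX.ne' h

/-- Error of maximum likelihood decoding. -/
lemma exists_decoder_avgErr_le (hW : IsKernel W) (hCT : CoverThomasSymmetric W) (x₀ : 𝓧) (γ : ℝ)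
    (hM : 0 < M) (f : Fin M → Fin n → 𝓧) :
    ∃ g, avgErr W n M f g ≤ iidF (W x₀) (centDen W x₀) n γ
      + (M : ℝ)⁻¹ * ∑ m, ∑ m' ∈ univ.erase m, confusion W n γ (f m) (f m') := by
  have : Nonempty (Fin M) := ⟨⟨0, hM⟩⟩
  choose g hg using fun y : Fin n → 𝓨 => Finite.exists_max fun m => ∏ i, W (f m i) (y i)
  refine ⟨g, ?_⟩
  have hM' : (0 : ℝ) < M := Nat.cast_pos.2 hM
  have lik0 : ∀ m (y : Fin n → 𝓨), 0 ≤ ∏ i, W (f m i) (y i) := fun m y =>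
    Finset.prod_nonneg fun i _ => hW.1 _ _
  have term : ∀ m (y : Fin n → 𝓨), ∏ i, W (f m i) (y i)
      ≤ (if g y = m then ∏ i, W (f m i) (y i) else 0)
        + (∏ i, W (f m i) (y i)) * (if ∑ i, centDen W (f m i) (y i) ≤ γ then 1 else 0)
        + ∑ m' ∈ univ.erase m, (if γ ≤ ∑ i, centDen W (f m i) (y i) ∧
          ∏ i, W (f m i) (y i) ≤ ∏ i, W (f m' i) (y i) then ∏ i, W (f m i) (y i) else 0) := by
    intro m y
    have hs : ∀ m' ∈ univ.erase m, 0 ≤ (if γ ≤ ∑ i, centDen W (f m i) (y i) ∧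
        ∏ i, W (f m i) (y i) ≤ ∏ i, W (f m' i) (y i) then ∏ i, W (f m i) (y i) else 0) :=
      fun m' _ => by split_ifs; exacts [lik0 m y, le_rfl]
    by_cases hgm : g y = m
    · rw [if_pos hgm, add_assoc]
      refine le_add_of_nonneg_right (add_nonneg (mul_nonneg (lik0 m y) ?_)
        (Finset.sum_nonneg hs))
      split_ifs <;> norm_num
    rw [if_neg hgm, zero_add]
    by_cases hγ : ∑ i, centDen W (f m i) (y i) ≤ γ
    · rw [if_pos hγ, mul_one]
      exact le_add_of_nonneg_right (Finset.sum_nonneg hs)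
    · rw [if_neg hγ, mul_zero, zero_add]
      refine le_trans ?_ (Finset.single_le_sum hs (Finset.mem_erase.2 ⟨hgm, Finset.mem_univ _⟩))
      rw [if_pos ⟨(not_le.1 hγ).le, hg y m⟩]
  have one : ∀ m, ∑ y : Fin n → 𝓨, ∏ i, W (f m i) (y i) = 1 := fun m => by
    have := sum_lik_row hW hCT x₀ (f m) fun w _ => w
    rw [this, ← iidE_const (hW.2 x₀) (centDen W x₀) n 1, iidE]
    simp
  have row : ∀ m, ∑ y : Fin n → 𝓨, (∏ i, W (f m i) (y i))
      * (if ∑ i, centDen W (f m i) (y i) ≤ γ then (1 : ℝ) else 0)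
      = iidF (W x₀) (centDen W x₀) n γ := fun m =>
    sum_lik_row hW hCT x₀ (f m) fun w s => w * (if s ≤ γ then 1 else 0)
  have h1 := Finset.sum_le_sum fun m (_ : m ∈ univ) =>
    Finset.sum_le_sum fun y (_ : y ∈ univ) => term m y
  simp only [Finset.sum_add_distrib, one, row] at h1
  have h2 : ∀ m, ∑ y : Fin n → 𝓨, ∑ m' ∈ univ.erase m, (if γ ≤ ∑ i, centDen W (f m i) (y i) ∧
      ∏ i, W (f m i) (y i) ≤ ∏ i, W (f m' i) (y i) then ∏ i, W (f m i) (y i) else 0)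
      = ∑ m' ∈ univ.erase m, confusion W n γ (f m) (f m') := fun m => Finset.sum_comm
  simp only [h2, Finset.sum_const, Finset.card_univ, Fintype.card_fin, nsmul_eq_mul,
    mul_one] at h1
  have h3 := mul_le_mul_of_nonneg_left h1 (inv_pos.2 hM').le
  rw [mul_add, mul_add, inv_mul_cancel₀ hM'.ne', inv_mul_cancel_left₀ hM'.ne'] at h3
  unfold avgErr
  linarith

/-- Random coding bound. -/
lemma existsCode_random (hW : IsKernel W) (hCT : CoverThomasSymmetric W) (x₀ : 𝓧) (γ : ℝ)
    (hM : 0 < M) :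
    ExistsCode W n M (iidF (W x₀) (centDen W x₀) n γ + M * (Real.exp (-(n * capacity W)) *
      iidE (W x₀) (centDen W x₀) n (fun s => if γ ≤ s then
        iidE (W x₀) (centDen W x₀) n (fun t => if s ≤ t then Real.exp (-t) else 0) else 0))) := by
  choose g hg using exists_decoder_avgErr_le (n := n) hW hCT x₀ γ hM
  set K := Real.exp (-(n * capacity W)) *
      iidE (W x₀) (centDen W x₀) n (fun s => if γ ≤ s then
        iidE (W x₀) (centDen W x₀) n (fun t => if s ≤ t then Real.exp (-t) else 0) else 0) with hK
  have hM' : (0 : ℝ) < M := Nat.cast_pos.2 hM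
  have hK0 : 0 ≤ K := by
    refine mul_nonneg (Real.exp_pos _).le (iidE_nonneg (hW.1 x₀) _ n fun s => ?_)
    split_ifs
    · exact iidE_nonneg (hW.1 x₀) _ n fun t => by split_ifs <;> positivity
    · exact le_rfl
  have h : ∑ f : Fin M → Fin n → 𝓧, avgErr W n M f (g f)
      ≤ ∑ _f : Fin M → Fin n → 𝓧, (iidF (W x₀) (centDen W x₀) n γ + M * K) := by
    refine (Finset.sum_le_sum fun f _ => hg f).trans ?_
    rw [Finset.sum_add_distrib, Finset.sum_add_distrib, ← Finset.mul_sum]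
    refine add_le_add le_rfl ?_
    rw [Finset.sum_comm, inv_mul_le_iff₀ hM']
    calc _ = ∑ m : Fin M, ∑ _m' ∈ univ.erase m,
          (Fintype.card (Fin M → Fin n → 𝓧) : ℝ) * K := by
          refine Finset.sum_congr rfl fun m _ => ?_
          rw [Finset.sum_comm]
          exact Finset.sum_congr rfl fun m' hm' =>
            sum_tuple_confusion hW hCT x₀ γ (Finset.mem_erase.1 hm').1
      _ ≤ ∑ m : Fin M, ∑ _m' : Fin M, (Fintype.card (Fin M → Fin n → 𝓧) : ℝ) * K :=
          Finset.sum_le_sum fun m _ => Finset.sum_le_sum_of_subset_of_nonneg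
            (Finset.erase_subset _ _) fun _ _ _ => by positivity
      _ = _ := by
          simp only [Finset.sum_const, Finset.card_univ, Fintype.card_fin, nsmul_eq_mul]
          ring
  obtain ⟨f, -, hf⟩ := Finset.exists_le_of_sum_le Finset.univ_nonempty h
  exact ⟨f, g f, hf⟩

end RandomCoding

section CodeSize

set_option linter.unusedSectionVars false

variable [Nonempty 𝓧] [Nonempty 𝓨]
  {W : 𝓧 → 𝓨 → ℝ} {n M : ℕ} {V B C θ : ℝ}

lemma existsCode_one (hW : IsKernel W) {e : ℝ} (he : 0 ≤ e) : ExistsCode W n 1 e := by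
  refine ⟨fun _ _ => Classical.arbitrary 𝓧, fun _ => 0, ?_⟩
  have h : ∑ y : Fin n → 𝓨, ∏ i, W (Classical.arbitrary 𝓧) (y i) = 1 := by
    rw [← iidE_const (hW.2 (Classical.arbitrary 𝓧)) (fun _ => 0) n 1, iidE]
    simp
  simp [avgErr, h, he]

lemma Mstar_le (hW : IsKernel W) {e Y : ℝ} (he : 0 ≤ e)
    (hY : ∀ M, ExistsCode W n M e → (M : ℝ) ≤ Y) : (Mstar W n e : ℝ) ≤ Y ∧ 1 ≤ Mstar W n e := by
  have hb : BddAbove {M | ExistsCode W n M e} :=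
    ⟨⌊Y⌋₊, fun M hM => Nat.le_floor (hY M hM)⟩
  have h1 : (1 : ℕ) ∈ {M | ExistsCode W n M e} := existsCode_one hW he
  exact ⟨hY _ (Nat.sSup_mem ⟨1, h1⟩ hb), le_csSup hb h1⟩

/-- Window length that compensates the error of the distribution function estimate. -/
def windowLen (V B C : ℝ) : ℝ :=
  Real.sqrt (2 * V) / gaussPhi 1 * (Real.exp 1 * (TiltControl.cdfConst V B C + 1) + 2 * tiltBE V B)

/-- The constant of the code size estimate. -/
def codeConst (V B C : ℝ) : ℝ :=
  2 * windowLen V B C + 2 * |Real.log (tiltTail V B)| + Real.log 2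

lemma windowLen_nonneg {α : Type*} [Fintype α] {p z : α → ℝ} (h : TiltControl p z V B C θ) :
    0 ≤ windowLen V B C := by
  have h1 := h.cdfConst_pos
  have h2 := h.tiltBE_pos
  have h3 := gaussPhi_pos 1
  unfold windowLen
  positivity

lemma le_window_windowLen {α : Type*} [Fintype α] {p z : α → ℝ} (h : TiltControl p z V B C θ)
    (hn : 0 < n) {a : ℝ} (hn2 : |a| + windowLen V B C ≤ Real.sqrt n * Real.sqrt (V / 2))
    (hθ : |θ| * (|a| + windowLen V B C) ≤ 1) :
    (TiltControl.cdfConst V B C + 1) * (Real.exp (-(n * tiltRate p z θ)) / Real.sqrt n)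
      ≤ iidF p z n (n * tiltMean p z θ + a + windowLen V B C)
        - iidF p z n (n * tiltMean p z θ + a) := by
  refine le_trans (le_of_eq ?_) (h.le_window hn (windowLen_nonneg h) hn2 hθ)
  congr 1
  have h3 := gaussPhi_pos 1
  have hV : 0 < Real.sqrt (2 * V) := Real.sqrt_pos.2 (by linarith [h.var_pos])
  have : gaussPhi 1 * (windowLen V B C / Real.sqrt (2 * V))
      = Real.exp 1 * (TiltControl.cdfConst V B C + 1) + 2 * tiltBE V B := by
    unfold windowLen
    field_simp
  rw [this, add_sub_cancel_right, ← mul_assoc, ← Real.exp_add]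
  simp

/-- Optimal code size in terms of an exponential tilting. -/
lemma abs_log_Mstar_sub_le (hW : IsKernel W) (hCT : CoverThomasSymmetric W) (x₀ : 𝓧)
    (h : TiltControl (W x₀) (centDen W x₀) V B C θ) (hn : 0 < n) {x : ℝ}
    (hx : x ^ 2 = 2 * (n * tiltRate (W x₀) (centDen W x₀) θ)) (hθx : θ * x ≤ 0) {e : ℝ}
    (he : 0 ≤ e) (hQ : gaussQ x = e)
    (hn2 : 2 * windowLen V B C ≤ Real.sqrt n * Real.sqrt (V / 2))
    (hθ : |θ| * (2 * windowLen V B C) ≤ 1) :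
    |Real.log (Mstar W n e) - (n * capacity W + n * tiltMean (W x₀) (centDen W x₀) θ
      + x ^ 2 / 2 + 1 / 2 * Real.log n)| ≤ codeConst V B C := by
  have hL := windowLen_nonneg h
  have hT := h.tiltTail_pos
  have hn' : (0 : ℝ) < n := Nat.cast_pos.2 hn
  have hsn : 0 < Real.sqrt n := Real.sqrt_pos.2 hn'
  have hlog2 := Real.log_nonneg (by norm_num : (1 : ℝ) ≤ 2)
  have hF := h.abs_cdf_sub_le hn hx hθx
  have w1 := le_window_windowLen h hn (a := 0) (by rw [abs_zero]; linarith)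
    ((mul_le_mul_of_nonneg_left (by rw [abs_zero]; linarith) (abs_nonneg θ)).trans hθ)
  have w2 := le_window_windowLen h hn (a := -windowLen V B C)
    (by rw [abs_neg, abs_of_nonneg hL]; linarith)
    (by rw [abs_neg, abs_of_nonneg hL, ← two_mul]; exact hθ)
  rw [add_zero] at w1
  rw [neg_add_cancel_right] at w2
  rw [hQ, _root_.abs_le] at hF
  have hJ : n * tiltRate (W x₀) (centDen W x₀) θ = x ^ 2 / 2 := by linarith
  have hconf := h.confusion_le hn hL
  rw [hJ] at w1 w2 hF hconf
  set s := n * tiltMean (W x₀) (centDen W x₀) θ with hs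
  set L := windowLen V B C with hLdef
  set E := Real.exp (-(x ^ 2 / 2)) / Real.sqrt n with hE
  have hE0 : 0 < E := by positivity
  have hsqrt : Real.log (Real.sqrt n) = 1 / 2 * Real.log n := by
    rw [Real.log_sqrt hn'.le]; ring
  have upper : ∀ M, ExistsCode W n M e →
      (M : ℝ) ≤ Real.exp (n * capacity W + s + x ^ 2 / 2 + L) * Real.sqrt n := by
    intro M hM
    have h1 := hM.mul_sub_le hW hCT x₀ (s + L)
    have h2 : E ≤ iidF (W x₀) (centDen W x₀) n (s + L) - e := by linarith [hF.1]
    have h3 := (mul_le_mul_of_nonneg_left h2 (Nat.cast_nonneg M)).trans h1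
    rw [← le_div_iff₀ hE0] at h3
    refine h3.trans (le_of_eq ?_)
    rw [hE, div_div_eq_mul_div, mul_div_right_comm, ← Real.exp_sub]
    congr 2; ring
  obtain ⟨hM1, hM2⟩ := Mstar_le hW he upper
  have hMpos : (0 : ℝ) < Mstar W n e := by exact_mod_cast hM2
  have hup := Real.log_le_log hMpos hM1
  rw [Real.log_mul (Real.exp_pos _).ne' hsn.ne', Real.log_exp, hsqrt] at hup
  set y := Real.exp (n * capacity W + s + x ^ 2 / 2 - 2 * L) * Real.sqrt n / tiltTail V B ^ 2
    with hy
  have hy0 : 0 < y := by positivity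
  have hlogy : Real.log y = n * capacity W + s + x ^ 2 / 2 - 2 * L + 1 / 2 * Real.log n
      - 2 * Real.log (tiltTail V B) := by
    rw [hy, Real.log_div (by positivity) (by positivity),
      Real.log_mul (Real.exp_pos _).ne' hsn.ne', Real.log_exp, hsqrt, Real.log_pow]
    norm_num
  have hlow : Real.log y - Real.log 2 ≤ Real.log (Mstar W n e) := by
    rcases lt_or_ge y 1 with hy1 | hy1
    · linarith [Real.log_nonpos hy0.le hy1.le, Real.log_natCast_nonneg (Mstar W n e)]
    have hfl : 0 < ⌊y⌋₊ := Nat.floor_pos.2 hy1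
    have hcode := existsCode_random (n := n) hW hCT x₀ (s - L) hfl
    have hbound : iidF (W x₀) (centDen W x₀) n (s - L) + ⌊y⌋₊ *
        (Real.exp (-(n * capacity W)) * iidE (W x₀) (centDen W x₀) n (fun s' => if s - L ≤ s' then
          iidE (W x₀) (centDen W x₀) n (fun t => if s' ≤ t then Real.exp (-t) else 0) else 0))
        ≤ e := by
      have h1 : iidF (W x₀) (centDen W x₀) n (s - L) ≤ e - E := by
        rw [sub_eq_add_neg s]; linarith [hF.2]
      have h2 : y * (Real.exp (-(n * capacity W)) * (tiltTail V B ^ 2 * Real.exp (2 * L)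
          * (Real.exp (-(2 * (x ^ 2 / 2)) - s) / n))) = E := by
        have e1 : Real.exp (n * capacity W + s + x ^ 2 / 2 - 2 * L) * Real.exp (-(n * capacity W))
            * Real.exp (2 * L) * Real.exp (-(2 * (x ^ 2 / 2)) - s)
            = Real.exp (-(x ^ 2 / 2)) := by
          rw [← Real.exp_add, ← Real.exp_add, ← Real.exp_add]
          congr 1; ring
        rw [hE, ← e1, hy]
        have e2 : (n : ℝ) = Real.sqrt n * Real.sqrt n := (Real.mul_self_sqrt hn'.le).symm
        generalize Real.exp (n * capacity W + s + x ^ 2 / 2 - 2 * L) = c1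
        generalize Real.exp (-(n * capacity W)) = c2
        generalize Real.exp (-(2 * (x ^ 2 / 2)) - s) = c3
        generalize Real.exp (2 * L) = c4
        generalize Real.sqrt n = r at *
        rw [e2]
        field_simp
      have h3 := mul_le_mul (Nat.floor_le hy0.le) (mul_le_mul_of_nonneg_left hconf
        (Real.exp_pos (-(n * capacity W))).le) (mul_nonneg (Real.exp_pos _).le
        (iidE_nonneg h.nonneg _ n fun s' => by
          split_ifs
          · exact iidE_nonneg h.nonneg _ n fun t => by split_ifs <;> positivity
          · exact le_rfl)) hy0.le
      rw [h2] at h3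
      linarith
    obtain ⟨f, g, hfg⟩ := hcode
    have hmem : ⌊y⌋₊ ≤ Mstar W n e :=
      le_csSup ⟨⌊Real.exp (n * capacity W + s + x ^ 2 / 2 + L) * Real.sqrt n⌋₊,
        fun M hM => Nat.le_floor (upper M hM)⟩ ⟨f, g, hfg.trans hbound⟩
    have hhalf : y / 2 ≤ ⌊y⌋₊ := by
      have h1 := Nat.lt_floor_add_one y
      have h2 : (1 : ℝ) ≤ ⌊y⌋₊ := by exact_mod_cast hfl
      linarith
    rw [← Real.log_div hy0.ne' two_ne_zero]
    exact Real.log_le_log (by positivity) (hhalf.trans (by exact_mod_cast hmem))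
  have habs := le_abs_self (Real.log (tiltTail V B))
  have habs0 := abs_nonneg (Real.log (tiltTail V B))
  unfold codeConst
  rw [_root_.abs_le]
  constructor <;> linarith

end CodeSize

section Asymptotics

lemma gaussQinv_sq_le {e : ℝ} (he : e ∈ Set.Ioo (0 : ℝ) 1) :
    gaussQinv e ^ 2 ≤ 1 + 2 * Real.log (1 / e) + 2 * Real.log (1 / (1 - e)) := by
  have h1e : 0 < 1 - e := by linarith [he.2]
  have hl1 : 0 ≤ Real.log (1 / e) := Real.log_nonneg (by rw [le_div_iff₀ he.1]; linarith [he.2])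
  have hl2 : 0 ≤ Real.log (1 / (1 - e)) :=
    Real.log_nonneg (by rw [le_div_iff₀ h1e]; linarith [he.1])
  have hQ := gaussQ_gaussQinv he
  set x := gaussQinv e
  have tail : ∀ {u v : ℝ}, 1 ≤ u → 0 < v → gaussQ u = v → u ^ 2 ≤ 2 * Real.log (1 / v) := by
    intro u v hu hv huv
    have h := Real.log_le_log hv (huv ▸ gaussQ_le_exp hu)
    rw [Real.log_exp] at h
    rw [one_div, Real.log_inv]
    linarith
  rcases le_total 1 x with hx | hx
  · linarith [tail hx he.1 hQ]
  rcases le_total x (-1) with hx' | hx'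
  · have := tail (u := -x) (by linarith) h1e (by rw [gaussQ_neg, hQ])
    rw [neg_sq] at this
    linarith
  · nlinarith

lemma IsSMD.tendsto_gaussQinv_div_sqrt {ε : ℕ → ℝ} (hε : IsSMD ε) :
    Tendsto (fun n : ℕ => gaussQinv (ε n) / Real.sqrt n) atTop (nhds 0) := by
  have h1 : Tendsto (fun n : ℕ => 1 / (n : ℝ) + 2 * (Real.log (1 / ε n) / n)
      + 2 * (Real.log (1 / (1 - ε n)) / n)) atTop (nhds 0) := by
    have := ((tendsto_one_div_atTop_nhds_zero_nat (𝕜 := ℝ)).add (hε.2.1.const_mul 2)).add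
      (hε.2.2.const_mul 2)
    simpa using this
  have h2 : Tendsto (fun n : ℕ => (gaussQinv (ε n) / Real.sqrt n) ^ 2) atTop (nhds 0) := by
    refine squeeze_zero (fun n => sq_nonneg _) (fun n => ?_) h1
    rw [div_pow, Real.sq_sqrt (Nat.cast_nonneg n)]
    refine (div_le_div_of_nonneg_right (gaussQinv_sq_le (hε.1 n)) (Nat.cast_nonneg n)).trans
      (le_of_eq ?_)
    ring
  have h3 := (Real.continuous_sqrt.tendsto 0).comp h2
  rw [Real.sqrt_zero] at h3
  refine (tendsto_zero_iff_abs_tendsto_zero _).2 (h3.congr fun n => ?_)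
  simp only [Function.comp_apply, Real.sqrt_sq_eq_abs]

variable {α : Type*} [Fintype α] {p z : α → ℝ} {V : ℝ}

/-- Small values of the signed root of the tilting rate are attained at small tiltings. -/
lemma eventually_exists_tilt (hp : ∀ a, 0 ≤ p a) (h1 : ∑ a, p a = 1) (h0 : ∑ a, p a * z a = 0)
    (hV : 0 < V) {δ : ℝ} (hδ : 0 < δ)
    (hJ : ∀ θ, |θ| ≤ δ → V * θ ^ 2 / 2 ≤ 2 * tiltRate p z θ) :
    ∀ᶠ w in nhds (0 : ℝ), ∃ θ, |θ| ≤ δ ∧ w ^ 2 = 2 * tiltRate p z θ ∧ θ * w ≤ 0 := by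
  have hc : Continuous fun θ => 2 * tiltRate p z θ :=
    continuous_const.mul (continuous_tiltRate hp h1 h0)
  have hz : 2 * tiltRate p z 0 = 0 := by simp [tiltRate, tiltM, h1]
  have hw : ∀ᶠ w in nhds (0 : ℝ), w ^ 2 < V * δ ^ 2 / 2 := by
    have : Tendsto (fun w : ℝ => w ^ 2) (nhds 0) (nhds (0 ^ 2)) := (continuous_pow 2).tendsto 0
    exact this.eventually (gt_mem_nhds (by rw [zero_pow two_ne_zero]; positivity))
  filter_upwards [hw] with w hw
  rcases le_total w 0 with hw0 | hw0
  · have hd := hJ δ (abs_of_pos hδ).le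
    obtain ⟨θ, hθ, e⟩ := intermediate_value_Icc hδ.le hc.continuousOn
      (show w ^ 2 ∈ Set.Icc _ _ from ⟨by rw [hz]; positivity, by linarith⟩)
    exact ⟨θ, by rw [abs_of_nonneg hθ.1]; exact hθ.2, e.symm,
      mul_nonpos_of_nonneg_of_nonpos hθ.1 hw0⟩
  · have hd := hJ (-δ) (by rw [abs_neg, abs_of_pos hδ])
    rw [neg_sq] at hd
    obtain ⟨θ, hθ, e⟩ := intermediate_value_Icc' (neg_nonpos.2 hδ.le) hc.continuousOn
      (show w ^ 2 ∈ Set.Icc _ _ from ⟨by rw [hz]; positivity, by linarith⟩)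
    exact ⟨θ, by rw [abs_of_nonpos hθ.2]; linarith [hθ.1], e.symm,
      mul_nonpos_of_nonpos_of_nonneg hθ.2 hw0⟩

lemma ctS_eq {W : 𝓧 → 𝓨 → ℝ} (hV : 0 < ctV W) :
    ctS W = ctMoment W 3 / (6 * ctV W) + 1 / 2 := by
  have e : ctV W ^ ((3 : ℝ) / 2) = ctV W * Real.sqrt (ctV W) := by
    rw [show (3 : ℝ) / 2 = 1 + 1 / 2 by norm_num, Real.rpow_add hV, Real.rpow_one,
      ← Real.sqrt_eq_rpow]
  have := Real.sqrt_pos.2 hV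
  rw [ctS, e]
  field_simp

lemma rpow_five_halves {v : ℝ} (hv : 0 < v) : v ^ ((5 : ℝ) / 2) = v ^ 2 * Real.sqrt v := by
  rw [show (5 : ℝ) / 2 = 2 + 1 / 2 by norm_num, Real.rpow_add hv, ← Real.sqrt_eq_rpow,
    Real.rpow_ofNat]

end Asymptotics

/-- Theorem 3, refined fourth-order expansion for Cover–Thomas symmetric
channels: for a Cover–Thomas symmetric channel with dispersion `V > 0` under the uniform
input distribution and an SMD sequence `ε_n`,
`ζ(n,ε_n) = (1/2)·log n + S·Q⁻¹(ε_n)² − [(3(μ₄ − 3V²)V − 4μ₃²)/(72 V^{5/2})]·Q⁻¹(ε_n)³/√n`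
`+ O(Q⁻¹(ε_n)⁴/n) + O(1)`. -/
theorem coverThomas_fourth_order_SMD
    {𝓧 𝓨 : Type*} [Fintype 𝓧] [Fintype 𝓨] [Nonempty 𝓧] [Nonempty 𝓨]
    (W : 𝓧 → 𝓨 → ℝ) (hW : IsKernel W)
    (hCT : CoverThomasSymmetric W)
    (hV : 0 < ctV W)
    (ε : ℕ → ℝ) (hε : IsSMD ε) :
    ∃ C : ℝ, ∀ᶠ n : ℕ in atTop,
      |ctZeta W n (ε n)
          - ((1 / 2) * Real.log n + ctS W * gaussQinv (ε n) ^ 2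
            - (3 * (ctMoment W 4 - 3 * ctV W ^ 2) * ctV W - 4 * ctMoment W 3 ^ 2)
                / (72 * ctV W ^ ((5 : ℝ) / 2))
              * (gaussQinv (ε n) ^ 3 / Real.sqrt n))|
        ≤ C * (gaussQinv (ε n) ^ 4 / n) + C := by
  obtain ⟨x₀⟩ := ‹Nonempty 𝓧›
  have : Nonempty 𝓧 := ⟨x₀⟩
  have h0 := sum_mul_centDen hW hCT x₀
  have hm2 : ∑ y, W x₀ y * centDen W x₀ y ^ 2 = ctV W := (ctMoment_eq hW hCT x₀ 2).symm
  obtain ⟨C, hC0, hC⟩ := exists_tilt_bounds (hW.1 x₀) (hW.2 x₀) h0 hm2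
    (ctMoment_eq hW hCT x₀ 3).symm (k := ctMoment W 4 - 3 * ctV W ^ 2)
    (by rw [← ctMoment_eq hW hCT x₀ 4]) hV
  set V := ctV W with hVdef
  set B := ∑ y, |centDen W x₀ y| + 1 with hB
  have hB0 : 0 < B := by positivity
  have hBle : ∀ y, |centDen W x₀ y| ≤ B := fun y => by
    have := Finset.single_le_sum (f := fun y => |centDen W x₀ y|) (fun y _ => abs_nonneg _)
      (Finset.mem_univ y)
    linarith
  obtain ⟨r, hr, hr'⟩ := Metric.eventually_nhds_iff.1 hC
  have hL1 : 0 < |2 * windowLen V B C| + 1 := by positivity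
  obtain ⟨δ, hδ0, hδr, hδ4, hδL⟩ : ∃ δ : ℝ, 0 < δ ∧ δ < r ∧ δ ≤ 1 / 4 ∧
      δ * (|2 * windowLen V B C| + 1) ≤ 1 := by
    refine ⟨min (r / 2) (min (1 / 4) (|2 * windowLen V B C| + 1)⁻¹), by positivity,
      (min_le_left _ _).trans_lt (by linarith), (min_le_right _ _).trans (min_le_left _ _), ?_⟩
    rw [← le_div_iff₀ hL1, one_div (_ + 1)]
    exact (min_le_right _ _).trans (min_le_right _ _)
  have hnear : ∀ {θ : ℝ}, |θ| ≤ δ → dist θ 0 < r := fun hθ => by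
    rw [Real.dist_eq, sub_zero]; exact hθ.trans_lt hδr
  have htilt := eventually_exists_tilt (hW.1 x₀) (hW.2 x₀) h0 hV hδ0
    fun θ hθ => (hr' (hnear hθ)).2.2.2.1
  have hsqrt : Tendsto (fun n : ℕ => Real.sqrt n * Real.sqrt (V / 2)) atTop atTop :=
    (Real.tendsto_sqrt_atTop.comp tendsto_natCast_atTop_atTop).atTop_mul_const
      (Real.sqrt_pos.2 (by positivity))
  refine ⟨|codeConst V B C| + C, ?_⟩
  filter_upwards [hε.tendsto_gaussQinv_div_sqrt.eventually htilt, eventually_gt_atTop 0,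
    hsqrt.eventually_ge_atTop (2 * windowLen V B C)] with n hθn hn hn2
  obtain ⟨θ, hθδ, hw, hθw⟩ := hθn
  obtain ⟨hv1, hv2, hc, hr1, -, hexp⟩ := hr' (hnear hθδ)
  have hctl : TiltControl (W x₀) (centDen W x₀) V B C θ :=
    ⟨hW.1 x₀, hW.2 x₀, hBle, one_le_tiltM (hW.1 x₀) (hW.2 x₀) h0 θ, hV, hB0, hC0,
      hθδ.trans hδ4, hv1, hv2, hc, hr1⟩
  have hn' : (0 : ℝ) < n := Nat.cast_pos.2 hn
  have hsn : 0 < Real.sqrt n := Real.sqrt_pos.2 hn'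
  have hsq : Real.sqrt n ^ 2 = n := Real.sq_sqrt hn'.le
  have hK := hexp _ hw hθw
  set x := gaussQinv (ε n) with hx
  have hx2 : x ^ 2 = 2 * (n * tiltRate (W x₀) (centDen W x₀) θ) := by
    rw [div_pow, hsq, div_eq_iff hn'.ne'] at hw
    linarith
  have hθx : θ * x ≤ 0 := by
    rw [← mul_div_assoc] at hθw
    by_contra hcon
    exact absurd hθw (not_le.2 (div_pos (not_le.1 hcon) hsn))
  have hcode := abs_log_Mstar_sub_le hW hCT x₀ hctl hn hx2 hθx (hε.1 n).1.le
    (gaussQ_gaussQinv (hε.1 n)) hn2 (by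
      have h1 := mul_le_mul_of_nonneg_right hθδ hL1.le
      have h2 := mul_le_mul_of_nonneg_left (le_abs_self (2 * windowLen V B C)) (abs_nonneg θ)
      nlinarith [abs_nonneg θ])
  have hexpand : |n * tiltMean (W x₀) (centDen W x₀) θ + Real.sqrt (n * V) * x
      - ctMoment W 3 / (6 * V) * x ^ 2
      + (3 * (ctMoment W 4 - 3 * V ^ 2) * V - 4 * ctMoment W 3 ^ 2) / (72 * (V ^ 2 * Real.sqrt V))
        * (x ^ 3 / Real.sqrt n)| ≤ C * (x ^ 4 / n) := by
    have h := mul_le_mul_of_nonneg_left hK hn'.le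
    rw [← abs_of_pos hn', ← abs_mul, abs_of_pos hn'] at h
    have e1 : (n : ℝ) * (x / Real.sqrt n) = Real.sqrt n * x := by
      rw [← hsq, Real.sqrt_sq hsn.le]; field_simp
    have e2 : (n : ℝ) * (x / Real.sqrt n) ^ 2 = x ^ 2 := by
      rw [div_pow, hsq]; field_simp
    have e3 : (n : ℝ) * (x / Real.sqrt n) ^ 3 = x ^ 3 / Real.sqrt n := by
      rw [pow_succ, ← mul_assoc, e2]; ring
    have e4 : (n : ℝ) * (x / Real.sqrt n) ^ 4 = x ^ 4 / n := by
      rw [div_pow, show Real.sqrt n ^ 4 = (Real.sqrt n ^ 2) ^ 2 by ring, hsq]; field_simp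
    calc _ = _ := by
          congr 1
          rw [Real.sqrt_mul hn'.le, ← e2, ← e3, mul_right_comm (Real.sqrt n), ← e1]
          ring
      _ ≤ _ := h
      _ = _ := by rw [mul_left_comm, e4]
  rw [ctS_eq hV, rpow_five_halves hV, ctZeta, ← hVdef, ← hx]
  have hx4 : 0 ≤ x ^ 4 / n := by positivity
  have hk := mul_nonneg (abs_nonneg (codeConst V B C)) hx4
  have hle := le_abs_self (codeConst V B C)
  rw [abs_le] at hcode hexpand ⊢
  constructor <;> linarith [hcode.1, hcode.2, hexpand.1, hexpand.2]
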